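/- arXiv:2309.13239 — 3 statements merged into one kernel-verified Lean document; each statement's English description precedes it below -/
import Mathlib

section
/- Let θ ∈ ℝ^p, n ∈ ℕ, σ² > 0, and let a_1 ≥ a_2 ≥ ⋯ ≥ a_p ≥ 0 be the decreasing rearrangement of (|θ_1|, …, |θ_p|). Then: (i) ρ^{MS}(θ) = min_{0 ≤ k ≤ p} [k σ²/n + Σ_{j=k+1}^{p} a_j²]; and (ii) Σ_{j=1}^{p} a_j² σ²/(n a_j² + σ²) ≤ ρ^{MA}(θ) ≤ σ²/n + Σ_{j=2}^{p} a_j² σ²/(n a_j² + σ²). -/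
/-- Risk of the subset model `I ⊆ {1, …, p}`: `|I| σ²/n + ∑_{j ∉ I} θ_j²`. -/
noncomputable def subsetMSRisk (n p : ℕ) (σ2 : ℝ) (θ : ℕ → ℝ) (I : Finset ℕ) : ℝ :=
  (I.card : ℝ) * σ2 / n + ∑ j ∈ Finset.Icc 1 p \ I, θ j ^ 2

/-- Ideal MS risk `ρ^{MS}(θ)`: minimum of the subset-model risks over all `I ⊆ {1, …, p}`. -/
noncomputable def rhoMS (n p : ℕ) (σ2 : ℝ) (θ : ℕ → ℝ) : ℝ :=
  sInf {r : ℝ | ∃ I : Finset ℕ, I ⊆ Finset.Icc 1 p ∧ r = subsetMSRisk n p σ2 θ I}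

/-- Coordinate weight `λ_j = ∑_{I : j ∈ I} w_I` induced by a weight vector over all subsets. -/
noncomputable def coordWeight (p : ℕ) (v : Finset ℕ → ℝ) (j : ℕ) : ℝ :=
  ∑ I ∈ (Finset.Icc 1 p).powerset.filter (fun I => j ∈ I), v I

/-- `v` is a weight vector over all subsets of `{1, …, p}`. -/
def IsSubsetWeight (p : ℕ) (v : Finset ℕ → ℝ) : Prop :=
  (∀ I ∈ (Finset.Icc 1 p).powerset, 0 ≤ v I) ∧ ∑ I ∈ (Finset.Icc 1 p).powerset, v I = 1

/-- All-subset model-averaging risk `∑_{j=1}^{p} [(1 − λ_j)² θ_j² + σ² λ_j²/n]`. -/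
noncomputable def subsetMARisk (n p : ℕ) (σ2 : ℝ) (θ : ℕ → ℝ) (v : Finset ℕ → ℝ) : ℝ :=
  ∑ j ∈ Finset.Icc 1 p,
    ((1 - coordWeight p v j) ^ 2 * θ j ^ 2 + σ2 * (coordWeight p v j) ^ 2 / n)

/-- Ideal MA risk `ρ^{MA}(θ)`: minimum of the all-subset MA risk over all weight vectors. -/
noncomputable def rhoMA (n p : ℕ) (σ2 : ℝ) (θ : ℕ → ℝ) : ℝ :=
  sInf {r : ℝ | ∃ v : Finset ℕ → ℝ, IsSubsetWeight p v ∧ r = subsetMARisk n p σ2 θ v}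

theorem card_mul_add_sum_sdiff_eq_sum_ite {ι : Type*} [DecidableEq ι] {s I : Finset ι}
    (hI : I ⊆ s) (c : ℝ) (f : ι → ℝ) :
    (I.card : ℝ) * c + ∑ j ∈ s \ I, f j = ∑ j ∈ s, if j ∈ I then c else f j := by
  rw [← Finset.sum_sdiff hI, add_comm]
  congr 1
  · exact Finset.sum_congr rfl fun j hj => (if_neg (Finset.mem_sdiff.1 hj).2).symm
  · rw [Finset.sum_congr rfl fun j hj => if_pos hj, Finset.sum_const, nsmul_eq_mul]

theorem sum_min_le_card_mul_add_sum_sdiff {ι : Type*} [DecidableEq ι] {s I : Finset ι}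
    (hI : I ⊆ s) (c : ℝ) (f : ι → ℝ) :
    ∑ j ∈ s, min c (f j) ≤ (I.card : ℝ) * c + ∑ j ∈ s \ I, f j := by
  rw [card_mul_add_sum_sdiff_eq_sum_ite hI]
  refine Finset.sum_le_sum fun j _ => ?_
  split_ifs
  · exact min_le_left _ _
  · exact min_le_right _ _

theorem card_mul_add_sum_sdiff_eq_sum_min {ι : Type*} [DecidableEq ι] {s I : Finset ι}
    (hI : I ⊆ s) (c : ℝ) (f : ι → ℝ) (hin : ∀ j ∈ I, c ≤ f j) (hout : ∀ j ∈ s \ I, f j ≤ c) :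
    (I.card : ℝ) * c + ∑ j ∈ s \ I, f j = ∑ j ∈ s, min c (f j) := by
  rw [card_mul_add_sum_sdiff_eq_sum_ite hI]
  refine Finset.sum_congr rfl fun j hj => ?_
  split_ifs with h
  · exact (min_eq_left (hin j h)).symm
  · exact (min_eq_right (hout j (Finset.mem_sdiff.2 ⟨hj, h⟩))).symm

theorem rhoMS_eq_sum_min (n p : ℕ) (σ2 : ℝ) (θ : ℕ → ℝ) :
    rhoMS n p σ2 θ = ∑ j ∈ Finset.Icc 1 p, min (σ2 / n) (θ j ^ 2) := by
  refine IsLeast.csInf_eq ⟨?_, ?_⟩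
  · refine ⟨(Finset.Icc 1 p).filter fun j => σ2 / n ≤ θ j ^ 2, Finset.filter_subset _ _, ?_⟩
    rw [subsetMSRisk, mul_div_assoc,
      card_mul_add_sum_sdiff_eq_sum_min (Finset.filter_subset _ _)]
    · exact fun j hj => (Finset.mem_filter.1 hj).2
    · intro j hj
      rw [Finset.mem_sdiff, Finset.mem_filter] at hj
      by_contra! h
      exact hj.2 ⟨hj.1, h.le⟩
  · rintro r ⟨I, hI, rfl⟩
    rw [subsetMSRisk, mul_div_assoc]
    exact sum_min_le_card_mul_add_sum_sdiff hI _ _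

theorem Icc_one_sdiff_Icc_one (k p : ℕ) :
    Finset.Icc 1 p \ Finset.Icc 1 k = Finset.Icc (k + 1) p := by
  ext j
  simp only [Finset.mem_sdiff, Finset.mem_Icc]
  omega

theorem sInf_nested_risk_eq_sum_min (p : ℕ) (c : ℝ) (b : ℕ → ℝ)
    (hb : AntitoneOn b (Set.Icc 1 p)) :
    sInf {r : ℝ | ∃ k ≤ p, r = (k : ℝ) * c + ∑ j ∈ Finset.Icc (k + 1) p, b j}
      = ∑ j ∈ Finset.Icc 1 p, min c (b j) := by
  classical
  have hcard (k : ℕ) : (k : ℝ) = ((Finset.Icc 1 k).card : ℝ) := by simp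
  refine IsLeast.csInf_eq ⟨?_, ?_⟩
  · set k := Nat.findGreatest (fun j => c ≤ b j) p with hk
    have hkp : k ≤ p := Nat.findGreatest_le p
    refine ⟨k, hkp, ?_⟩
    rw [hcard, ← Icc_one_sdiff_Icc_one k p,
      card_mul_add_sum_sdiff_eq_sum_min (Finset.Icc_subset_Icc_right hkp)]
    · intro j hj
      rw [Finset.mem_Icc] at hj
      have hck : c ≤ b k :=
        Nat.findGreatest_of_ne_zero (P := fun j => c ≤ b j) hk.symm (by omega)
      exact hck.trans (hb ⟨hj.1, hj.2.trans hkp⟩ ⟨hj.1.trans hj.2, hkp⟩ hj.2)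
    · intro j hj
      rw [Icc_one_sdiff_Icc_one, Finset.mem_Icc] at hj
      exact (not_le.1 (Nat.findGreatest_is_greatest (P := fun j => c ≤ b j) hj.1 hj.2)).le
  · rintro r ⟨k, hkp, rfl⟩
    rw [hcard, ← Icc_one_sdiff_Icc_one k p]
    exact sum_min_le_card_mul_add_sum_sdiff (Finset.Icc_subset_Icc_right hkp) _ _

theorem coordinate_risk_eq {m s : ℝ} (hm : 0 < m) (hs : 0 < s) (x l : ℝ) :
    (1 - l) ^ 2 * x ^ 2 + s * l ^ 2 / m
      = x ^ 2 * s / (m * x ^ 2 + s)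
        + ((m * x ^ 2 + s) * l - m * x ^ 2) ^ 2 / (m * (m * x ^ 2 + s)) := by
  have h : 0 < m * x ^ 2 + s := by positivity
  field_simp
  ring

theorem sum_powerset_prod_mul_prod_one_sub {ι : Type*} [DecidableEq ι] (s : Finset ι)
    (l : ι → ℝ) :
    ∑ I ∈ s.powerset, (∏ i ∈ I, l i) * ∏ i ∈ s \ I, (1 - l i) = 1 := by
  rw [← Finset.prod_add]
  simp

theorem sum_powerset_filter_mem_prod_mul_prod_one_sub {ι : Type*} [DecidableEq ι] {s : Finset ι}
    (l : ι → ℝ) {j : ι} (hj : j ∈ s) :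
    ∑ I ∈ s.powerset.filter (fun I => j ∈ I), (∏ i ∈ I, l i) * ∏ i ∈ s \ I, (1 - l i) = l j := by
  have key := Finset.prod_add l (fun i => if i = j then 0 else 1 - l i) s
  have hprod : ∏ i ∈ s, (l i + if i = j then 0 else 1 - l i) = l j := by
    rw [Finset.prod_eq_single_of_mem j hj]
    · simp
    · intro i _ hij
      simp [hij]
  rw [← hprod, key, Finset.sum_filter]
  refine Finset.sum_congr rfl fun I _ => ?_
  split_ifs with hjI
  · congr 1
    refine Finset.prod_congr rfl fun i hi => ?_
    rw [if_neg]
    rintro rfl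
    exact (Finset.mem_sdiff.1 hi).2 hjI
  · symm
    apply mul_eq_zero_of_right
    apply Finset.prod_eq_zero (Finset.mem_sdiff.2 ⟨hj, hjI⟩)
    simp

theorem rhoMA_eq_sum (n p : ℕ) (hn : 0 < n) (σ2 : ℝ) (hσ : 0 < σ2) (θ : ℕ → ℝ) :
    rhoMA n p σ2 θ = ∑ j ∈ Finset.Icc 1 p, θ j ^ 2 * σ2 / (n * θ j ^ 2 + σ2) := by
  have hm : (0 : ℝ) < n := Nat.cast_pos.2 hn
  have hden (j : ℕ) : 0 < n * θ j ^ 2 + σ2 := by positivity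
  refine IsLeast.csInf_eq ⟨?_, ?_⟩
  · set l : ℕ → ℝ := fun j => n * θ j ^ 2 / (n * θ j ^ 2 + σ2) with hl
    have hl0 (j : ℕ) : 0 ≤ l j := by have := hden j; positivity
    have hl1 (j : ℕ) : 0 ≤ 1 - l j := by
      rw [sub_nonneg, hl]
      exact div_le_one_of_le₀ (by linarith) (hden j).le
    refine ⟨fun I => (∏ i ∈ I, l i) * ∏ i ∈ Finset.Icc 1 p \ I, (1 - l i), ⟨fun I _ => ?_, ?_⟩, ?_⟩
    · exact mul_nonneg (Finset.prod_nonneg fun i _ => hl0 i) (Finset.prod_nonneg fun i _ => hl1 i)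
    · exact sum_powerset_prod_mul_prod_one_sub _ l
    · refine Finset.sum_congr rfl fun j hj => ?_
      rw [coordWeight, sum_powerset_filter_mem_prod_mul_prod_one_sub l hj,
        coordinate_risk_eq hm hσ, hl, mul_div_cancel₀ _ (hden j).ne']
      simp
  · rintro r ⟨v, -, rfl⟩
    refine Finset.sum_le_sum fun j _ => ?_
    rw [coordinate_risk_eq hm hσ]
    have := hden j
    exact le_add_of_nonneg_right (by positivity)

/-- Let `θ ∈ ℝ^p` and let `a_1 ≥ a_2 ≥ ⋯ ≥ a_p ≥ 0` be the decreasing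
rearrangement of `(|θ_1|, …, |θ_p|)`.  Then
(i) `ρ^{MS}(θ) = min_{0 ≤ k ≤ p} [k σ²/n + ∑_{j=k+1}^{p} a_j²]`; and
(ii) `∑_{j=1}^{p} a_j² σ²/(n a_j² + σ²) ≤ ρ^{MA}(θ)
      ≤ σ²/n + ∑_{j=2}^{p} a_j² σ²/(n a_j² + σ²)`. -/
theorem stmt_9 (n p : ℕ) (hn : 0 < n) (σ2 : ℝ) (hσ : 0 < σ2)
    (θ a : ℕ → ℝ)
    (hmono : ∀ j, 1 ≤ j → j < p → a (j + 1) ≤ a j)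
    (hnonneg : ∀ j, 1 ≤ j → j ≤ p → 0 ≤ a j)
    (hperm : ((Finset.Icc 1 p).val.map fun j => |θ j|)
        = ((Finset.Icc 1 p).val.map fun j => a j)) :
    rhoMS n p σ2 θ
        = sInf {r : ℝ | ∃ k ≤ p,
            r = (k : ℝ) * σ2 / n + ∑ j ∈ Finset.Icc (k + 1) p, a j ^ 2}
    ∧ ∑ j ∈ Finset.Icc 1 p, a j ^ 2 * σ2 / (n * a j ^ 2 + σ2) ≤ rhoMA n p σ2 θ
    ∧ rhoMA n p σ2 θ ≤ σ2 / n + ∑ j ∈ Finset.Icc 2 p, a j ^ 2 * σ2 / (n * a j ^ 2 + σ2) := by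
  have hm : (0 : ℝ) < n := Nat.cast_pos.2 hn
  have hsum (f : ℝ → ℝ) :
      ∑ j ∈ Finset.Icc 1 p, f (θ j ^ 2) = ∑ j ∈ Finset.Icc 1 p, f (a j ^ 2) := by
    have h := congrArg (fun M : Multiset ℝ => (M.map fun x => f (x ^ 2)).sum) hperm
    simpa only [Multiset.map_map, Function.comp_def, sq_abs, Finset.sum_eq_multiset_sum] using h
  have hanti : AntitoneOn a (Set.Icc 1 p) := by
    intro i hi j hj hij
    induction j, hij using Nat.le_induction with
    | base => exact le_rfl
    | succ j hij ih =>
      have hj' : 1 ≤ j ∧ j < p := ⟨hi.1.trans hij, hj.2⟩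
      exact (hmono j hj'.1 hj'.2).trans (ih ⟨hj'.1, hj'.2.le⟩)
  have hanti_sq : AntitoneOn (fun j => a j ^ 2) (Set.Icc 1 p) := fun i hi j hj hij =>
    pow_le_pow_left₀ (hnonneg j hj.1 hj.2) (hanti hi hj hij) 2
  have hMA := (rhoMA_eq_sum n p hn σ2 hσ θ).trans (hsum fun x => x * σ2 / (n * x + σ2))
  refine ⟨?_, hMA.ge, ?_⟩
  · simp only [mul_div_assoc]
    rw [rhoMS_eq_sum_min, hsum fun x => min (σ2 / n) x]
    exact (sInf_nested_risk_eq_sum_min p _ _ hanti_sq).symm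
  · rw [hMA]
    rcases Nat.eq_zero_or_pos p with rfl | hp
    · simpa using (div_pos hσ hm).le
    · rw [← Finset.add_sum_Ioc_eq_sum_Icc (f := fun j => a j ^ 2 * σ2 / (n * a j ^ 2 + σ2)) hp]
      have hIoc : Finset.Ioc 1 p = Finset.Icc 2 p := rfl
      rw [hIoc]
      refine add_le_add_left ?_ _
      rw [div_le_div_iff₀ (by positivity) hm]
      nlinarith [sq_nonneg σ2]
end

section
/- Let α > 0, c > 0, σ² > 0, θ_j = exp(−c j^{α}) for j ≥ 1, and p_n = n with candidate sizes 1, …, n. Then: (i) m_n* / ((1/(2c)) log(n/σ²))^{1/α} → 1 as n → ∞; and (ii) n · min_{w ∈ W_n} R_n(w) ≍ (log n)^{1/α} and n · R_n(m_n*) ≍ (log n)^{1/α}. -/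
/-- Cumulative weight `γ j = ∑_{m=j}^{M} w m`. -/
noncomputable def cumw (M : ℕ) (w : ℕ → ℝ) (j : ℕ) : ℝ := ∑ m ∈ Finset.Icc j M, w m

/-- Nested model-averaging risk with candidate sizes `k_m = m`, `m = 1, …, M`:
`R_n(w) = ∑_{j=1}^{M} [(1−γ_j)² θ_j² + σ² γ_j²/n] + ∑_{l=M+1}^{p} θ_l²`. -/
noncomputable def nestedRisk (n p M : ℕ) (σ2 : ℝ) (θ : ℕ → ℝ) (w : ℕ → ℝ) : ℝ :=
  (∑ j ∈ Finset.Icc 1 M, ((1 - cumw M w j) ^ 2 * θ j ^ 2 + σ2 * (cumw M w j) ^ 2 / n))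
    + ∑ l ∈ Finset.Icc (M + 1) p, θ l ^ 2

/-- Risk of the single nested model of size `m`: `R_n(m) = m σ²/n + ∑_{l=m+1}^{p} θ_l²`. -/
noncomputable def msRisk (n p : ℕ) (σ2 : ℝ) (θ : ℕ → ℝ) (m : ℕ) : ℝ :=
  (m : ℝ) * σ2 / n + ∑ l ∈ Finset.Icc (m + 1) p, θ l ^ 2

/-- `w` belongs to the simplex `W_M`. -/
def InSimplex (M : ℕ) (w : ℕ → ℝ) : Prop :=
  (∀ m ∈ Finset.Icc 1 M, 0 ≤ w m) ∧ ∑ m ∈ Finset.Icc 1 M, w m = 1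

/-- `w` belongs to the discrete weight set `W_M(N)`:
each weight is a multiple of `1/N` in `[0,1]` and the weights sum to one. -/
def InSimplexN (M N : ℕ) (w : ℕ → ℝ) : Prop :=
  InSimplex M w ∧ ∀ m ∈ Finset.Icc 1 M, ∃ t : ℕ, t ≤ N ∧ w m = (t : ℝ) / N

/-- Condition 1 (slowly decaying coefficients): there are `κ > 1`, `0 < δ ≤ ν < 1` with
`κν² < 1` such that `δ ≤ |θ ⌊κ l⌋ / θ l| ≤ ν` for all sufficiently large `l`. -/
def Condition1 (θ : ℕ → ℝ) : Prop :=
  ∃ κ δ ν : ℝ, 1 < κ ∧ 0 < δ ∧ δ ≤ ν ∧ ν < 1 ∧ κ * ν ^ 2 < 1 ∧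
    ∀ᶠ l : ℕ in Filter.atTop,
      δ ≤ |θ ⌊κ * (l : ℝ)⌋₊ / θ l| ∧ |θ ⌊κ * (l : ℝ)⌋₊ / θ l| ≤ ν

/-- Condition 2 (fast decaying coefficients): for every `κ > 1`,
`|θ ⌊κ l⌋ / θ l| → 0` as `l → ∞`. -/
def Condition2 (θ : ℕ → ℝ) : Prop :=
  ∀ κ : ℝ, 1 < κ →
    Filter.Tendsto (fun l : ℕ => |θ ⌊κ * (l : ℝ)⌋₊ / θ l|) Filter.atTop (nhds 0)

/-- `a ≍ b`: there are constants `0 < c ≤ C` with `c b_n ≤ a_n ≤ C b_n` eventually. -/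
def AsympEquiv (a b : ℕ → ℝ) : Prop :=
  ∃ c C : ℝ, 0 < c ∧ c ≤ C ∧ ∀ᶠ n in Filter.atTop, c * b n ≤ a n ∧ a n ≤ C * b n

/-- `a = o(b)`: `a_n / b_n → 0`. -/
def LittleO (a b : ℕ → ℝ) : Prop :=
  Filter.Tendsto (fun n => a n / b n) Filter.atTop (nhds 0)

section ExponentialDecay

open Filter Topology

/-- Solution `x` of `exp (-c x ^ α) ^ 2 = σ2 / n`. -/
noncomputable def expThreshold (α c σ2 : ℝ) (n : ℕ) : ℝ :=
  (1 / (2 * c) * Real.log ((n : ℝ) / σ2)) ^ (1 / α)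

theorem tendsto_log_div_atTop {s : ℝ} (hs : 0 < s) :
    Tendsto (fun n : ℕ => Real.log ((n : ℝ) / s)) atTop atTop :=
  Real.tendsto_log_atTop.comp (tendsto_natCast_atTop_atTop.atTop_div_const hs)

theorem tendsto_log_div_div_log {s : ℝ} (hs : 0 < s) :
    Tendsto (fun n : ℕ => Real.log ((n : ℝ) / s) / Real.log n) atTop (𝓝 1) := by
  have hlog : Tendsto (fun n : ℕ => Real.log (n : ℝ)) atTop atTop :=
    Real.tendsto_log_atTop.comp tendsto_natCast_atTop_atTop
  have h : Tendsto (fun n : ℕ => 1 - Real.log s / Real.log n) atTop (𝓝 (1 - 0)) :=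
    tendsto_const_nhds.sub (hlog.const_div_atTop _)
  rw [sub_zero] at h
  refine h.congr' ?_
  filter_upwards [hlog.eventually_gt_atTop 0, eventually_gt_atTop 0] with n hn hn'
  rw [Real.log_div (by positivity) hs.ne']
  field_simp

theorem tendsto_expThreshold_atTop {α c σ2 : ℝ} (hα : 0 < α) (hc : 0 < c) (hσ : 0 < σ2) :
    Tendsto (expThreshold α c σ2) atTop atTop :=
  (tendsto_rpow_atTop (by positivity)).comp
    ((tendsto_log_div_atTop hσ).const_mul_atTop (by positivity))

theorem tendsto_expThreshold_div {α c σ2 : ℝ} (hα : 0 < α) (hc : 0 < c) (hσ : 0 < σ2) :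
    Tendsto (fun n : ℕ => expThreshold α c σ2 n / Real.log (n : ℝ) ^ (1 / α)) atTop
      (𝓝 ((1 / (2 * c)) ^ (1 / α))) := by
  have h := ((tendsto_log_div_div_log hσ).const_mul (1 / (2 * c))).rpow_const
    (p := 1 / α) (Or.inr (by positivity))
  rw [mul_one] at h
  refine h.congr' ?_
  have hlog : Tendsto (fun n : ℕ => Real.log (n : ℝ)) atTop atTop :=
    Real.tendsto_log_atTop.comp tendsto_natCast_atTop_atTop
  filter_upwards [hlog.eventually_gt_atTop 0, (tendsto_log_div_atTop hσ).eventually_gt_atTop 0]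
    with n hn hn'
  rw [expThreshold, ← mul_div_assoc, Real.div_rpow (by positivity) hn.le]

theorem exists_expThreshold_bounds {α c σ2 : ℝ} (hα : 0 < α) (hc : 0 < c) (hσ : 0 < σ2) :
    ∃ a b : ℝ, 0 < a ∧ 0 < b ∧ ∀ᶠ n : ℕ in atTop,
      a * Real.log (n : ℝ) ^ (1 / α) ≤ expThreshold α c σ2 n ∧
        expThreshold α c σ2 n ≤ b * Real.log (n : ℝ) ^ (1 / α) := by
  set K : ℝ := (1 / (2 * c)) ^ (1 / α) with hK
  have hK0 : 0 < K := by positivity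
  have h := tendsto_expThreshold_div hα hc hσ
  have hlog : Tendsto (fun n : ℕ => Real.log (n : ℝ)) atTop atTop :=
    Real.tendsto_log_atTop.comp tendsto_natCast_atTop_atTop
  refine ⟨K / 2, 2 * K, by positivity, by positivity, ?_⟩
  filter_upwards [h.eventually_const_lt (show K / 2 < K by linarith),
    h.eventually_lt_const (show K < 2 * K by linarith), hlog.eventually_gt_atTop 0]
    with n h1 h2 hn
  have hp : 0 < Real.log (n : ℝ) ^ (1 / α) := Real.rpow_pos_of_pos hn _
  exact ⟨((lt_div_iff₀ hp).1 h1).le, ((div_lt_iff₀ hp).1 h2).le⟩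

theorem eventually_mul_expThreshold_add_one_le {α c σ2 : ℝ} (hα : 0 < α) (hc : 0 < c)
    (hσ : 0 < σ2) {A : ℝ} (hA : 0 < A) :
    ∀ᶠ n : ℕ in atTop, A * expThreshold α c σ2 n + 1 ≤ n := by
  obtain ⟨a, b, ha, hb, hab⟩ := exists_expThreshold_bounds hα hc hσ
  have ho := ((isLittleO_log_rpow_rpow_atTop (s := 1) (1 / α) one_pos).comp_tendsto
    (tendsto_natCast_atTop_atTop (R := ℝ))).bound (c := 1 / (2 * A * b)) (by positivity)
  have hlog : Tendsto (fun n : ℕ => Real.log (n : ℝ)) atTop atTop :=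
    Real.tendsto_log_atTop.comp tendsto_natCast_atTop_atTop
  filter_upwards [ho, hab, hlog.eventually_gt_atTop 0, eventually_ge_atTop 2] with n h1 h2 hn h3
  have hp : 0 < Real.log (n : ℝ) ^ (1 / α) := Real.rpow_pos_of_pos hn _
  have h3' : (2 : ℝ) ≤ n := by exact_mod_cast h3
  simp only [Function.comp_apply, Real.rpow_one, Real.norm_eq_abs, abs_of_pos hp,
    abs_of_nonneg (show (0 : ℝ) ≤ n by positivity)] at h1
  have h4 : A * expThreshold α c σ2 n ≤ A * (b * (1 / (2 * A * b) * n)) := by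
    have := h2.2.trans (mul_le_mul_of_nonneg_left h1 hb.le)
    gcongr
  have h5 : A * (b * (1 / (2 * A * b) * n)) = n / 2 := by field_simp
  linarith

theorem summable_exp_neg_mul_rpow {α c : ℝ} (hα : 0 < α) (hc : 0 < c) :
    Summable (fun l : ℕ => Real.exp (-(c * (l : ℝ) ^ α))) := by
  have h1 : Tendsto (fun l : ℕ => (l : ℝ) ^ α) atTop atTop :=
    (tendsto_rpow_atTop hα).comp tendsto_natCast_atTop_atTop
  have ho := (isLittleO_exp_neg_mul_rpow_atTop hc (-(2 / α))).comp_tendsto h1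
  refine summable_of_isBigO_nat (Real.summable_nat_rpow.2 (show (-2 : ℝ) < -1 by norm_num)) ?_
  refine (ho.isBigO.congr (fun l => ?_) (fun l => ?_))
  · simp
  · simp only [Function.comp_apply]
    rw [← Real.rpow_mul (by positivity)]
    congr 1
    field_simp

theorem exp_neg_mul_expThreshold {α c σ2 : ℝ} (hα : 0 < α) (hc : 0 < c) (hσ : 0 < σ2) {n : ℕ}
    (hn : 0 < n) (hL : 0 ≤ Real.log ((n : ℝ) / σ2)) :
    Real.exp (-(2 * c * expThreshold α c σ2 n ^ α)) = σ2 / n := by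
  have hn' : (0 : ℝ) < n := by exact_mod_cast hn
  rw [expThreshold, ← Real.rpow_mul (by positivity), one_div_mul_cancel hα.ne', Real.rpow_one,
    ← mul_assoc, mul_one_div_cancel (by positivity), one_mul, Real.exp_neg,
    Real.exp_log (by positivity), inv_div]

theorem le_sq_exp_iff {α c u x : ℝ} (hα : 0 < α) (hc : 0 < c) (hx : 0 ≤ x)
    (hu : Real.exp (-(2 * c * x ^ α)) = u) {y : ℝ} (hy : 0 ≤ y) :
    u ≤ Real.exp (-(c * y ^ α)) ^ 2 ↔ y ≤ x := by
  rw [← hu, ← Real.exp_nat_mul, Real.exp_le_exp, ← Real.rpow_le_rpow_iff hy hx hα]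
  push_cast
  constructor <;> intro h <;> nlinarith

theorem sq_exp_le_iff {α c u x : ℝ} (hα : 0 < α) (hc : 0 < c) (hx : 0 ≤ x)
    (hu : Real.exp (-(2 * c * x ^ α)) = u) {y : ℝ} (hy : 0 ≤ y) :
    Real.exp (-(c * y ^ α)) ^ 2 ≤ u ↔ x ≤ y := by
  rw [← hu, ← Real.exp_nat_mul, Real.exp_le_exp, ← Real.rpow_le_rpow_iff hx hy hα]
  push_cast
  constructor <;> intro h <;> nlinarith

theorem msRisk_succ (n : ℕ) (σ2 : ℝ) (θ : ℕ → ℝ) {m : ℕ} (hm : m + 1 ≤ n) :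
    msRisk n n σ2 θ m = msRisk n n σ2 θ (m + 1) - σ2 / n + θ (m + 1) ^ 2 := by
  unfold msRisk
  rw [← Finset.insert_Icc_add_one_left_eq_Icc hm, Finset.sum_insert (by simp)]
  push_cast
  ring

/-- The risk of a nested model is the averaging risk of the weight concentrated on it. -/
theorem nestedRisk_single {n m : ℕ} (σ2 : ℝ) (θ : ℕ → ℝ) (hm : m ≤ n) :
    nestedRisk n n n σ2 θ (Pi.single m 1) = msRisk n n σ2 θ m := by
  have hcum : ∀ j, cumw n (Pi.single m 1) j = if j ≤ m then 1 else 0 := by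
    intro j
    simp [cumw, hm]
  have hsplit : Finset.Icc 1 n = Finset.Icc 1 m ∪ Finset.Icc (m + 1) n := by
    ext j; simp only [Finset.mem_union, Finset.mem_Icc]; omega
  have hdisj : Disjoint (Finset.Icc 1 m) (Finset.Icc (m + 1) n) := by
    rw [Finset.disjoint_left]; intro j; simp only [Finset.mem_Icc]; omega
  rw [nestedRisk, msRisk, Finset.Icc_eq_empty (a := n + 1) (by omega), Finset.sum_empty, add_zero,
    hsplit, Finset.sum_union hdisj]
  congr 1
  · rw [Finset.sum_congr rfl (g := fun _ => σ2 / n)]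
    · simp [mul_div_assoc]
    · intro j hj
      simp [hcum, (Finset.mem_Icc.1 hj).2]
  · refine Finset.sum_congr rfl fun j hj => ?_
    have : ¬ j ≤ m := by have := (Finset.mem_Icc.1 hj).1; omega
    simp [hcum, this]

theorem inSimplex_single {n m : ℕ} (hm : m ∈ Finset.Icc 1 n) : InSimplex n (Pi.single m 1) := by
  refine ⟨fun j _ => ?_, ?_⟩
  · rw [Pi.single_apply]; split_ifs <;> norm_num
  · rw [Finset.sum_pi_single', if_pos hm]

/-- If the first `m` squared coefficients dominate the noise level `σ2 / n`, each of the first `m`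
blocks contributes at least half the noise level to the averaging risk. -/
theorem half_le_nestedRisk {n m : ℕ} {σ2 : ℝ} (hσ : 0 ≤ σ2) (θ w : ℕ → ℝ) (hm : m ≤ n)
    (h : ∀ j ∈ Finset.Icc 1 m, σ2 / n ≤ θ j ^ 2) :
    m * (σ2 / n) / 2 ≤ nestedRisk n n n σ2 θ w := by
  have hu : 0 ≤ σ2 / n := by positivity
  rw [nestedRisk, Finset.Icc_eq_empty (a := n + 1) (by omega), Finset.sum_empty, add_zero]
  calc (m : ℝ) * (σ2 / n) / 2 = ∑ j ∈ Finset.Icc 1 m, σ2 / n / 2 := by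
        simp [mul_div_assoc]
    _ ≤ ∑ j ∈ Finset.Icc 1 m,
          ((1 - cumw n w j) ^ 2 * θ j ^ 2 + σ2 * (cumw n w j) ^ 2 / n) := by
        refine Finset.sum_le_sum fun j hj => ?_
        have h1 := mul_le_mul_of_nonneg_left (h j hj) (sq_nonneg (1 - cumw n w j))
        have h2 : σ2 * (cumw n w j) ^ 2 / n = cumw n w j ^ 2 * (σ2 / n) := by ring
        rw [h2]
        nlinarith [mul_nonneg hu (sq_nonneg (2 * cumw n w j - 1))]
    _ ≤ _ := Finset.sum_le_sum_of_subset_of_nonneg (Finset.Icc_subset_Icc_right hm)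
        fun j _ _ => by positivity

theorem mul_sInf_bounds {n m : ℕ} {σ2 : ℝ} (hσ : 0 ≤ σ2) (θ : ℕ → ℝ) (hm : m ∈ Finset.Icc 1 n)
    (h : ∀ j ∈ Finset.Icc 1 m, σ2 / n ≤ θ j ^ 2) :
    m * σ2 / 2 ≤ n * sInf {r : ℝ | ∃ w, InSimplex n w ∧ r = nestedRisk n n n σ2 θ w} ∧
    n * sInf {r : ℝ | ∃ w, InSimplex n w ∧ r = nestedRisk n n n σ2 θ w}
      ≤ n * msRisk n n σ2 θ m := by
  have hmn := Finset.mem_Icc.1 hm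
  have hn : (0 : ℝ) < n := by exact_mod_cast hmn.1.trans hmn.2
  have hmem : msRisk n n σ2 θ m ∈ {r : ℝ | ∃ w, InSimplex n w ∧ r = nestedRisk n n n σ2 θ w} :=
    ⟨_, inSimplex_single hm, (nestedRisk_single σ2 θ hmn.2).symm⟩
  have hlow : ∀ r ∈ {r : ℝ | ∃ w, InSimplex n w ∧ r = nestedRisk n n n σ2 θ w},
      m * (σ2 / n) / 2 ≤ r := by
    rintro r ⟨w, -, rfl⟩
    exact half_le_nestedRisk hσ θ w hmn.2 h
  constructor
  · calc (m : ℝ) * σ2 / 2 = n * (m * (σ2 / n) / 2) := by field_simp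
      _ ≤ _ := by gcongr; exact le_csInf ⟨_, hmem⟩ hlow
  · gcongr
    exact csInf_le ⟨_, hlow⟩ hmem

/-- A smallest minimizer of the single-model risk lies within one of the threshold. -/
theorem minimizer_bounds {α c σ2 x : ℝ} (hα : 0 < α) (hc : 0 < c) {θ : ℕ → ℝ}
    (hθ : ∀ j, 1 ≤ j → θ j = Real.exp (-(c * (j : ℝ) ^ α))) {n k : ℕ}
    (hx : 1 ≤ x) (hxn : x ≤ n) (hu : Real.exp (-(2 * c * x ^ α)) = σ2 / n)
    (hk : k ∈ Finset.Icc 1 n)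
    (hmin : ∀ m ∈ Finset.Icc 1 n, msRisk n n σ2 θ k ≤ msRisk n n σ2 θ m) :
    (k : ℝ) ≤ x ∧ x - 1 ≤ k := by
  have hkn := Finset.mem_Icc.1 hk
  have key : ∀ j : ℕ, 1 ≤ j → (σ2 / n ≤ θ j ^ 2 ↔ (j : ℝ) ≤ x) := fun j hj => by
    rw [hθ j hj]; exact le_sq_exp_iff hα hc (by linarith) hu (by positivity)
  constructor
  · obtain ⟨j, rfl⟩ : ∃ j, k = j + 1 := ⟨k - 1, by omega⟩
    rcases Nat.eq_zero_or_pos j with rfl | hj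
    · simpa using hx
    · have h1 := hmin j (Finset.mem_Icc.2 ⟨hj, by omega⟩)
      rw [msRisk_succ n σ2 θ hkn.2] at h1
      exact (key _ hkn.1).1 (by linarith)
  · rcases hkn.2.eq_or_lt with h | h
    · rw [h]; linarith
    · have h1 := hmin (k + 1) (Finset.mem_Icc.2 ⟨by omega, h⟩)
      rw [msRisk_succ n σ2 θ h] at h1
      have h2 := (sq_exp_le_iff hα hc (by linarith) hu (y := ((k + 1 : ℕ) : ℝ))
        (by positivity)).1 (by rw [← hθ _ (by omega)]; linarith)
      push_cast at h2
      linarith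

/-- Beyond the threshold of twice the exponent, the tail of the squared coefficients is of the
order of the noise level. -/
theorem msRisk_tail_bound {α c σ2 x : ℝ} (hα : 0 < α) (hc : 0 < c) {θ : ℕ → ℝ}
    (hθ : ∀ j, 1 ≤ j → θ j = Real.exp (-(c * (j : ℝ) ^ α))) {n m : ℕ}
    (hσ : 0 < σ2) (hn : 0 < n) (hx : 0 ≤ x) (hu : Real.exp (-(2 * c * x ^ α)) = σ2 / n)
    (hm : (2 : ℝ) ^ (1 / α) * x ≤ m) :
    n * msRisk n n σ2 θ m ≤ σ2 * (m + ∑' l : ℕ, Real.exp (-(c * (l : ℝ) ^ α))) := by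
  have hn' : (0 : ℝ) < n := by exact_mod_cast hn
  have hterm : ∀ l ∈ Finset.Icc (m + 1) n,
      θ l ^ 2 ≤ σ2 / n * Real.exp (-(c * (l : ℝ) ^ α)) := by
    intro l hl
    have hl1 : m + 1 ≤ l := (Finset.mem_Icc.1 hl).1
    have hml : (m : ℝ) ≤ l := by exact_mod_cast (by omega : m ≤ l)
    have h1 : 2 * x ^ α ≤ (l : ℝ) ^ α := by
      have := Real.rpow_le_rpow (by positivity) (hm.trans hml) hα.le
      rwa [Real.mul_rpow (by positivity) hx, ← Real.rpow_mul (by norm_num),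
        one_div_mul_cancel hα.ne', Real.rpow_one] at this
    rw [hθ l (by omega), sq, ← hu, ← Real.exp_add, ← Real.exp_add, Real.exp_le_exp]
    nlinarith
  have hsum : ∑ l ∈ Finset.Icc (m + 1) n, θ l ^ 2
      ≤ σ2 / n * ∑' l : ℕ, Real.exp (-(c * (l : ℝ) ^ α)) := by
    refine (Finset.sum_le_sum hterm).trans ?_
    rw [← Finset.mul_sum]
    gcongr
    exact (summable_exp_neg_mul_rpow hα hc).sum_le_tsum _ fun l _ => (Real.exp_pos _).le
  calc n * msRisk n n σ2 θ m
      ≤ n * (m * σ2 / n + σ2 / n * ∑' l : ℕ, Real.exp (-(c * (l : ℝ) ^ α))) := by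
        unfold msRisk; gcongr
    _ = _ := by field_simp

end ExponentialDecay

/-- Example 2 of the paper: exponentially decaying coefficients.
Let `θ_j = exp(−c j^{α})` with `α, c > 0`, `p_n = n`, candidate sizes `1, …, n`.  Then
(i) `m_n* ∼ ((1/(2c)) log(n/σ²))^{1/α}`; and (ii) `n · min_{w} R_n(w) ≍ (log n)^{1/α}`
and `n · R_n(m_n*) ≍ (log n)^{1/α}`. -/
theorem stmt_15 (α c σ2 : ℝ) (hα : 0 < α) (hc : 0 < c) (hσ : 0 < σ2)
    (θ : ℕ → ℝ) (hθ : ∀ j, 1 ≤ j → θ j = Real.exp (-(c * (j : ℝ) ^ α)))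
    (mstar : ℕ → ℕ)
    (hmem : ∀ n, 1 ≤ n → mstar n ∈ Finset.Icc 1 n)
    (hmin : ∀ n, ∀ m ∈ Finset.Icc 1 n, msRisk n n σ2 θ (mstar n) ≤ msRisk n n σ2 θ m)
    (hleast : ∀ n, ∀ m ∈ Finset.Icc 1 n,
        msRisk n n σ2 θ m = msRisk n n σ2 θ (mstar n) → mstar n ≤ m)
    (Rstar : ℕ → ℝ)
    (hRstar : ∀ n, Rstar n
        = sInf {r : ℝ | ∃ w, InSimplex n w ∧ r = nestedRisk n n n σ2 θ w}) :
    Filter.Tendsto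
        (fun n => (mstar n : ℝ) / ((1 / (2 * c) * Real.log ((n : ℝ) / σ2)) ^ (1 / α)))
        Filter.atTop (nhds 1)
    ∧ AsympEquiv (fun n => (n : ℝ) * Rstar n)
        (fun n => Real.log (n : ℝ) ^ (1 / α))
    ∧ AsympEquiv (fun n => (n : ℝ) * msRisk n n σ2 θ (mstar n))
        (fun n => Real.log (n : ℝ) ^ (1 / α)) := by
  have hev : ∀ᶠ n : ℕ in Filter.atTop, 2 ≤ expThreshold α c σ2 n ∧
      expThreshold α c σ2 n - 1 ≤ mstar n ∧ (mstar n : ℝ) ≤ expThreshold α c σ2 n ∧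
      mstar n * σ2 / 2 ≤ n * Rstar n ∧ n * Rstar n ≤ n * msRisk n n σ2 θ (mstar n) ∧
      n * msRisk n n σ2 θ (mstar n) ≤ σ2 * ((2 : ℝ) ^ (1 / α) + 1
        + ∑' l : ℕ, Real.exp (-(c * (l : ℝ) ^ α))) * expThreshold α c σ2 n := by
    have hA : (0 : ℝ) < (2 : ℝ) ^ (1 / α) := by positivity
    filter_upwards [(tendsto_expThreshold_atTop hα hc hσ).eventually_ge_atTop 2,
      eventually_mul_expThreshold_add_one_le hα hc hσ one_pos,
      eventually_mul_expThreshold_add_one_le hα hc hσ hA,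
      (tendsto_log_div_atTop hσ).eventually_ge_atTop 0, Filter.eventually_gt_atTop 0]
      with n hx2 hxn hAn hL hn
    have hu := exp_neg_mul_expThreshold hα hc hσ hn hL
    set x := expThreshold α c σ2 n
    obtain ⟨hup, hlow⟩ := minimizer_bounds hα hc hθ (by linarith) (by linarith) hu
      (hmem n hn) (hmin n)
    have hdom : ∀ j ∈ Finset.Icc 1 (mstar n), σ2 / n ≤ θ j ^ 2 := by
      intro j hj
      rw [Finset.mem_Icc] at hj
      rw [hθ j hj.1, le_sq_exp_iff hα hc (by linarith) hu (by positivity)]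
      exact le_trans (by exact_mod_cast hj.2) hup
    have hR := mul_sInf_bounds hσ.le θ (hmem n hn) hdom
    rw [← hRstar n] at hR
    refine ⟨hx2, hlow, hup, hR.1, hR.2, ?_⟩
    set m := ⌈(2 : ℝ) ^ (1 / α) * x⌉₊
    have hm1 : (m : ℝ) < (2 : ℝ) ^ (1 / α) * x + 1 := Nat.ceil_lt_add_one (by positivity)
    have hmI : m ∈ Finset.Icc 1 n := Finset.mem_Icc.2
      ⟨Nat.ceil_pos.2 (by positivity), by exact_mod_cast hm1.le.trans hAn⟩
    have hS : 0 ≤ ∑' l : ℕ, Real.exp (-(c * (l : ℝ) ^ α)) :=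
      tsum_nonneg fun l => (Real.exp_pos _).le
    calc n * msRisk n n σ2 θ (mstar n) ≤ n * msRisk n n σ2 θ m := by
          gcongr; exact hmin n m hmI
      _ ≤ σ2 * (m + ∑' l : ℕ, Real.exp (-(c * (l : ℝ) ^ α))) :=
          msRisk_tail_bound hα hc hθ hσ hn (by linarith) hu (Nat.le_ceil _)
      _ ≤ _ := by
          rw [mul_assoc]
          gcongr
          nlinarith
  set B : ℝ := σ2 * ((2 : ℝ) ^ (1 / α) + 1 + ∑' l : ℕ, Real.exp (-(c * (l : ℝ) ^ α)))
  have hB : 0 ≤ B := mul_nonneg hσ.le (add_nonneg (by positivity)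
    (tsum_nonneg fun l => (Real.exp_pos _).le))
  obtain ⟨a, b, ha, hb, hab⟩ := exists_expThreshold_bounds hα hc hσ
  have hbounds : ∀ᶠ n : ℕ in Filter.atTop,
      σ2 / 4 * a * Real.log (n : ℝ) ^ (1 / α) ≤ n * Rstar n ∧
      n * Rstar n ≤ n * msRisk n n σ2 θ (mstar n) ∧
      n * msRisk n n σ2 θ (mstar n)
        ≤ max (σ2 / 4 * a) (B * b) * Real.log (n : ℝ) ^ (1 / α) := by
    filter_upwards [hev, hab, Filter.eventually_ge_atTop 1] with n h h' hn
    obtain ⟨hx2, hlow, hup, h1, h2, h3⟩ := h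
    have hlog : 0 ≤ Real.log (n : ℝ) ^ (1 / α) :=
      Real.rpow_nonneg (Real.log_natCast_nonneg n) _
    refine ⟨le_trans ?_ h1, h2, h3.trans ?_⟩
    · have h4 : a * Real.log (n : ℝ) ^ (1 / α) ≤ 2 * mstar n := by linarith
      nlinarith
    · calc B * expThreshold α c σ2 n ≤ B * (b * Real.log (n : ℝ) ^ (1 / α)) := by
            gcongr; exact h'.2
        _ = B * b * Real.log (n : ℝ) ^ (1 / α) := by ring
        _ ≤ _ := by gcongr; exact le_max_right _ _
  refine ⟨?_, ⟨σ2 / 4 * a, max (σ2 / 4 * a) (B * b), by positivity, le_max_left _ _, ?_⟩,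
    ⟨σ2 / 4 * a, max (σ2 / 4 * a) (B * b), by positivity, le_max_left _ _, ?_⟩⟩
  · have hlim : Filter.Tendsto (fun n => 1 - 1 / expThreshold α c σ2 n) Filter.atTop
        (nhds (1 - 0)) :=
      tendsto_const_nhds.sub ((tendsto_expThreshold_atTop hα hc hσ).const_div_atTop 1)
    rw [sub_zero] at hlim
    refine tendsto_of_tendsto_of_tendsto_of_le_of_le' hlim tendsto_const_nhds ?_ ?_
    · filter_upwards [hev] with n h
      have hx : 0 < expThreshold α c σ2 n := by linarith [h.1]
      change _ ≤ (mstar n : ℝ) / expThreshold α c σ2 n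
      rw [le_div_iff₀ hx, sub_mul, one_mul, one_div_mul_cancel hx.ne']
      exact h.2.1
    · filter_upwards [hev] with n h
      have hx : 0 < expThreshold α c σ2 n := by linarith [h.1]
      change (mstar n : ℝ) / expThreshold α c σ2 n ≤ _
      rw [div_le_one hx]
      exact h.2.2.1
  · filter_upwards [hbounds] with n h using ⟨h.1, h.2.1.trans h.2.2⟩
  · filter_upwards [hbounds] with n h using ⟨h.1.trans h.2.1, h.2.2⟩
end

section
/- Fix α > 1/2 and σ² > 0. For n ∈ ℕ and θ ∈ ℝⁿ, let P_θ be the law on ℝⁿ of y = θ + e, where e has independent N(0, σ²/n) coordinates. Let Θ_n be the set of all θ ∈ ℝⁿ that are permutations of the vector (1^{−α}, 2^{−α}, …, n^{−α}), and let ρ_n = ρ^{MA}(θ) for θ ∈ Θ_n (this value is the same for every θ ∈ Θ_n). Then: (i) there is a constant c > 0 (depending only on α and σ²) such that for every n and every Borel-measurable estimator θ̂ : ℝⁿ → ℝⁿ, sup_{θ ∈ Θ_n} E_{P_θ} ‖θ̂(y) − θ‖² ≥ c (n/log n)^{−1+1/(2α)}, while ρ_n ≍ n^{−1+1/(2α)};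 consequently (ii) for every sequence of Borel-measurable estimators θ̂_n : ℝⁿ → ℝⁿ there exist θ^{(n)} ∈ Θ_n with E_{P_{θ^{(n)}}} ‖θ̂_n(y) − θ^{(n)}‖² / ρ_n → ∞ as n → ∞. -/
/-- `Θ_n`: the set of vectors `θ ∈ ℝⁿ` whose coordinates are a permutation of
`(1^{−α}, 2^{−α}, …, n^{−α})`. -/
def ThetaSet (α : ℝ) (n : ℕ) : Set (Fin n → ℝ) :=
  {θ | ∃ e : Equiv.Perm (Fin n), ∀ j, θ j = (((e j : ℕ) : ℝ) + 1) ^ (-α)}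

/-- The law `P_θ` of `y = θ + e` where `e` has independent `N(0, σ²/n)` coordinates. -/
noncomputable def seqLaw (σ2 : ℝ) (n : ℕ) (θ : Fin n → ℝ) :
    MeasureTheory.Measure (Fin n → ℝ) :=
  MeasureTheory.Measure.pi fun i => ProbabilityTheory.gaussianReal (θ i) ((σ2 / n).toNNReal)


open MeasureTheory ProbabilityTheory
open scoped ENNReal NNReal

/-- Tonelli's theorem for a product of functions of the separate coordinates. -/
lemma lintegral_fin_prod_eq_prod {n : ℕ} {μ : Fin n → Measure ℝ} [∀ i, SigmaFinite (μ i)]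
    {f : Fin n → ℝ → ℝ≥0∞} (hf : ∀ i, Measurable (f i)) :
    ∫⁻ x, ∏ i, f i (x i) ∂(Measure.pi μ) = ∏ i, ∫⁻ x, f i x ∂(μ i) := by
  induction n with
  | zero => simp
  | succ n ih =>
    have h0 : Measurable fun y : Fin n → ℝ => ∏ i : Fin n, f i.succ (y i) :=
      Finset.measurable_prod _ fun i _ => (hf i.succ).comp (measurable_pi_apply i)
    calc
      _ = ∫⁻ x : ℝ × (Fin n → ℝ), f 0 x.1 * ∏ i : Fin n, f i.succ (x.2 i)
            ∂((μ 0).prod (Measure.pi fun i => μ i.succ)) := by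
          rw [← ((measurePreserving_piFinSuccAbove μ 0).symm).lintegral_comp_emb
            (MeasurableEquiv.measurableEmbedding _)]
          simp_rw [MeasurableEquiv.piFinSuccAbove_symm_apply, Fin.insertNthEquiv,
            Fin.prod_univ_succ, Fin.insertNth_zero, Equiv.coe_fn_mk, Fin.cons_succ,
            Fin.zero_succAbove, Fin.cons_zero]
          rfl
      _ = (∫⁻ x, f 0 x ∂μ 0) * ∏ i : Fin n, ∫⁻ x, f i.succ x ∂(μ i.succ) := by
          rw [← ih fun i => hf i.succ, ← lintegral_prod_mul (hf 0).aemeasurable h0.aemeasurable]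
      _ = ∏ i, ∫⁻ x, f i x ∂(μ i) := by rw [Fin.prod_univ_succ]

/-- The joint density of independent Gaussian coordinates with common variance. -/
lemma pi_gaussianReal_eq_withDensity {n : ℕ} (m : Fin n → ℝ) {v : ℝ≥0} (hv : v ≠ 0) :
    (Measure.pi fun i => gaussianReal (m i) v)
      = volume.withDensity fun x : Fin n → ℝ => ∏ i, gaussianPDF (m i) v (x i) := by
  refine Measure.pi_eq fun s hs => ?_
  rw [withDensity_apply _ (MeasurableSet.univ_pi hs), ← lintegral_indicator
    (MeasurableSet.univ_pi hs)]
  have h : (Set.univ.pi s).indicator (fun x : Fin n → ℝ => ∏ i, gaussianPDF (m i) v (x i))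
      = fun x => ∏ i, (s i).indicator (gaussianPDF (m i) v) (x i) := by
    ext x
    by_cases hx : x ∈ Set.univ.pi s
    · rw [Set.indicator_of_mem hx]
      exact Finset.prod_congr rfl fun i _ => by
        rw [Set.indicator_of_mem (hx i (Set.mem_univ i))]
    · rw [Set.indicator_of_notMem hx]
      obtain ⟨i, hi⟩ : ∃ i, x i ∉ s i := by simpa [Set.mem_pi] using hx
      exact (Finset.prod_eq_zero (Finset.mem_univ i) (Set.indicator_of_notMem hi _)).symm
  rw [h, volume_pi, lintegral_fin_prod_eq_prod
    fun i => (measurable_gaussianPDF (m i) v).indicator (hs i)]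
  refine Finset.prod_congr rfl fun i _ => ?_
  rw [lintegral_indicator (hs i), gaussianReal_apply _ hv]

lemma gaussianPDF_eq_rpow_mul_rpow (a b x : ℝ) {v : ℝ≥0} (hv : v ≠ 0) :
    gaussianPDF b v x = gaussianPDF a v x ^ (1 / 2 : ℝ)
      * (ENNReal.ofReal (Real.exp ((b - a) ^ 2 / v)) * gaussianPDF (2 * b - a) v x)
        ^ (1 / 2 : ℝ) := by
  have hv' : (v : ℝ) ≠ 0 := by exact_mod_cast hv
  rw [← ENNReal.mul_rpow_of_nonneg _ _ (by norm_num : (0 : ℝ) ≤ 1 / 2)]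
  simp only [gaussianPDF]
  rw [← ENNReal.ofReal_mul (Real.exp_pos _).le,
    ← ENNReal.ofReal_mul (gaussianPDFReal_nonneg _ _ _),
    ENNReal.ofReal_rpow_of_nonneg (mul_nonneg (gaussianPDFReal_nonneg _ _ _)
      (mul_nonneg (Real.exp_pos _).le (gaussianPDFReal_nonneg _ _ _))) (by norm_num),
    ← Real.sqrt_eq_rpow]
  congr 1
  symm
  rw [Real.sqrt_eq_iff_mul_self_eq (mul_nonneg (gaussianPDFReal_nonneg _ _ _)
      (mul_nonneg (Real.exp_pos _).le (gaussianPDFReal_nonneg _ _ _)))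
      (gaussianPDFReal_nonneg _ _ _)]
  simp only [gaussianPDFReal]
  have : Real.exp (-(x - b) ^ 2 / (2 * v)) * Real.exp (-(x - b) ^ 2 / (2 * v))
      = Real.exp (-(x - a) ^ 2 / (2 * v)) * (Real.exp ((b - a) ^ 2 / v)
        * Real.exp (-(x - (2 * b - a)) ^ 2 / (2 * v))) := by
    rw [← Real.exp_add, ← Real.exp_add, ← Real.exp_add]
    congr 1
    field_simp
    ring
  linear_combination (-((√(2 * Real.pi * v))⁻¹) ^ 2) * this

/-- Change of measure between two Gaussian product measures through their `χ²`-divergence. -/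
lemma pi_gaussianReal_sq_le {n : ℕ} (a b : Fin n → ℝ) {v : ℝ≥0} (hv : v ≠ 0)
    {A : Set (Fin n → ℝ)} (hA : MeasurableSet A) :
    (Measure.pi (fun i => gaussianReal (b i) v) A) ^ 2
      ≤ ENNReal.ofReal (Real.exp ((∑ i, (b i - a i) ^ 2) / v))
        * Measure.pi (fun i => gaussianReal (a i) v) A := by
  set c : Fin n → ℝ := fun i => 2 * b i - a i
  have hmeas : ∀ m : Fin n → ℝ, Measurable fun x : Fin n → ℝ => ∏ i, gaussianPDF (m i) v (x i) :=
    fun m => Finset.measurable_prod _ fun i _ =>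
      (measurable_gaussianPDF (m i) v).comp (measurable_pi_apply i)
  set C := ENNReal.ofReal (Real.exp ((∑ i, (b i - a i) ^ 2) / v)) with hC
  have hCprod : C = ∏ i, ENNReal.ofReal (Real.exp ((b i - a i) ^ 2 / v)) := by
    rw [hC, Finset.sum_div, Real.exp_sum, ENNReal.ofReal_prod_of_nonneg
      fun i _ => (Real.exp_pos _).le]
  have hpt : ∀ x : Fin n → ℝ, ∏ i, gaussianPDF (b i) v (x i)
      = (∏ i, gaussianPDF (a i) v (x i)) ^ (1 / 2 : ℝ)
        * (C * ∏ i, gaussianPDF (c i) v (x i)) ^ (1 / 2 : ℝ) := by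
    intro x
    rw [hCprod, ← Finset.prod_mul_distrib,
      ← ENNReal.prod_rpow_of_nonneg (by norm_num), ← ENNReal.prod_rpow_of_nonneg (by norm_num),
      ← Finset.prod_mul_distrib]
    exact Finset.prod_congr rfl fun i _ => gaussianPDF_eq_rpow_mul_rpow _ _ _ hv
  have hb : Measure.pi (fun i => gaussianReal (b i) v) A
      ≤ (Measure.pi (fun i => gaussianReal (a i) v) A) ^ (1 / 2 : ℝ) * C ^ (1 / 2 : ℝ) := by
    have h1 : ∀ m : Fin n → ℝ, Measure.pi (fun i => gaussianReal (m i) v) A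
        = ∫⁻ x in A, ∏ i, gaussianPDF (m i) v (x i) := fun m => by
      rw [pi_gaussianReal_eq_withDensity _ hv, withDensity_apply _ hA]
    rw [h1 b, h1 a]
    simp_rw [hpt]
    refine (ENNReal.lintegral_mul_norm_pow_le (hmeas a).aemeasurable
      ((hmeas c).const_mul C).aemeasurable (by norm_num) (by norm_num) (by norm_num)).trans ?_
    gcongr
    rw [lintegral_const_mul _ (hmeas c), ← h1 c]
    exact mul_le_of_le_one_right zero_le prob_le_one
  calc _ ≤ ((Measure.pi (fun i => gaussianReal (a i) v) A) ^ (1 / 2 : ℝ) * C ^ (1 / 2 : ℝ)) ^ 2 := by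
        gcongr
    _ = _ := by
      rw [mul_pow, ← ENNReal.rpow_natCast, ← ENNReal.rpow_natCast, ← ENNReal.rpow_mul,
        ← ENNReal.rpow_mul]
      norm_num [mul_comm]


lemma seqLaw_real_sq_le {σ2 : ℝ} (hσ : 0 < σ2) {n : ℕ} (hn : 0 < n) (a b : Fin n → ℝ)
    {A : Set (Fin n → ℝ)} (hA : MeasurableSet A) :
    (seqLaw σ2 n b).real A ^ 2
      ≤ Real.exp (n / σ2 * ∑ i, (b i - a i) ^ 2) * (seqLaw σ2 n a).real A := by
  have hpos : 0 < σ2 / n := by positivity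
  have h := pi_gaussianReal_sq_le a b (Real.toNNReal_pos.2 hpos).ne' hA
  rw [Real.coe_toNNReal _ hpos.le] at h
  have hexp : (∑ i, (b i - a i) ^ 2) / (σ2 / n) = n / σ2 * ∑ i, (b i - a i) ^ 2 := by
    field_simp
  rw [hexp] at h
  have h2 := ENNReal.toReal_mono
    (ENNReal.mul_ne_top ENNReal.ofReal_ne_top (measure_ne_top _ _)) h
  rwa [ENNReal.toReal_pow, ENNReal.toReal_mul, ENNReal.toReal_ofReal (Real.exp_pos _).le] at h2

instance (σ2 : ℝ) (n : ℕ) (θ : Fin n → ℝ) : IsProbabilityMeasure (seqLaw σ2 n θ) := by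
  unfold seqLaw; infer_instance

/-- Among many hypotheses that are all `χ²`-close to a common reference measure, no test can
identify the true one with average probability larger than one half. -/
lemma sum_measureReal_le_half {Ω ι : Type*} [MeasurableSpace Ω] (P₀ : Measure Ω)
    [IsProbabilityMeasure P₀] (P : ι → Measure Ω) (S : Finset ι) (A : ι → Set Ω)
    (hA : ∀ s ∈ S, MeasurableSet (A s)) (hd : (S : Set ι).PairwiseDisjoint A) {C : ℝ}
    (hP : ∀ s ∈ S, (P s).real (A s) ^ 2 ≤ C * P₀.real (A s)) (hC0 : 0 ≤ C)
    (hC : 4 * C ≤ S.card) :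
    ∑ s ∈ S, (P s).real (A s) ≤ S.card / 2 := by
  have h1 : ∑ s ∈ S, P₀.real (A s) ≤ 1 := by
    rw [← measureReal_biUnion_finset hd hA]
    exact measureReal_le_one
  have h2 : (∑ s ∈ S, (P s).real (A s)) ^ 2 ≤ S.card * C := by
    refine sq_sum_le_card_mul_sum_sq.trans ?_
    gcongr
    calc ∑ s ∈ S, (P s).real (A s) ^ 2 ≤ ∑ s ∈ S, C * P₀.real (A s) := Finset.sum_le_sum hP
      _ = C * ∑ s ∈ S, P₀.real (A s) := by rw [Finset.mul_sum]
      _ ≤ C * 1 := by gcongr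
      _ = C := mul_one C
  refine abs_le_of_sq_le_sq' ?_ (by positivity) |>.2
  nlinarith [(Nat.cast_nonneg S.card : (0 : ℝ) ≤ S.card)]

/-- Squared loss of `T` at the parameter `f ∘ e`, over the coordinates that carry the values
indexed by `V`. -/
noncomputable def blockLoss {n : ℕ} (f : Fin n → ℝ) (T : (Fin n → ℝ) → Fin n → ℝ)
    (V : Finset (Fin n)) (e : Equiv.Perm (Fin n)) (y : Fin n → ℝ) : ℝ :=
  ∑ j with e j ∈ V, (T y j - f (e j)) ^ 2

/-- Risk of `T` at the parameter `f ∘ e`, over the coordinates that carry the values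
indexed by `V`. -/
noncomputable def blockRisk (σ2 : ℝ) {n : ℕ} (f : Fin n → ℝ) (T : (Fin n → ℝ) → Fin n → ℝ)
    (V : Finset (Fin n)) (e : Equiv.Perm (Fin n)) : ℝ≥0∞ :=
  ∫⁻ y, ENNReal.ofReal (blockLoss f T V e y) ∂(seqLaw σ2 n (f ∘ e))

lemma measurable_blockLoss {n : ℕ} (f : Fin n → ℝ) {T : (Fin n → ℝ) → Fin n → ℝ}
    (hT : Measurable T) (V : Finset (Fin n)) (e : Equiv.Perm (Fin n)) :
    Measurable (blockLoss f T V e) :=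
  Finset.measurable_sum _ fun j _ =>
    (((measurable_pi_apply j).comp hT).sub_const _).pow_const 2

lemma sq_sub_le_blockLoss {n : ℕ} (f : Fin n → ℝ) (T : (Fin n → ℝ) → Fin n → ℝ)
    {V : Finset (Fin n)} {e : Equiv.Perm (Fin n)} (y : Fin n → ℝ) {j : Fin n} (hj : e j ∈ V) :
    (T y j - f (e j)) ^ 2 ≤ blockLoss f T V e y :=
  Finset.single_le_sum (f := fun j => (T y j - f (e j)) ^ 2) (fun _ _ => sq_nonneg _)
    (Finset.mem_filter.2 ⟨Finset.mem_univ j, hj⟩)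

/-- Markov's inequality for the block risk. -/
lemma ofReal_le_blockRisk (σ2 : ℝ) {n : ℕ} (f : Fin n → ℝ) {T : (Fin n → ℝ) → Fin n → ℝ}
    (hT : Measurable T) (V : Finset (Fin n)) (e : Equiv.Perm (Fin n)) {r : ℝ} (hr : 0 ≤ r) :
    ENNReal.ofReal (r * (1 - (seqLaw σ2 n (f ∘ e)).real {y | blockLoss f T V e y < r}))
      ≤ blockRisk σ2 f T V e := by
  have hm := measurable_blockLoss f hT V e
  have hA : MeasurableSet {y | blockLoss f T V e y < r} := measurableSet_lt hm measurable_const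
  rw [← probReal_compl_eq_one_sub hA, ENNReal.ofReal_mul hr, ofReal_measureReal]
  refine le_trans ?_ (mul_meas_ge_le_lintegral hm.ennreal_ofReal (ENNReal.ofReal r))
  gcongr
  intro y hy
  exact ENNReal.ofReal_le_ofReal (not_lt.1 hy)

lemma not_both_sq_lt {x u v δ : ℝ} (hδ : 0 ≤ δ) (huv : δ ≤ |u - v|)
    (hu : (x - u) ^ 2 < δ ^ 2 / 4) (hv : (x - v) ^ 2 < δ ^ 2 / 4) : False := by
  have h1 : |x - u| < δ / 2 := abs_lt_of_sq_lt_sq (by linarith) (by linarith)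
  have h2 : |x - v| < δ / 2 := abs_lt_of_sq_lt_sq (by linarith) (by linarith)
  have h3 : |u - v| ≤ |x - u| + |x - v| := by
    rw [abs_sub_comm x u]; simpa using abs_add_le (u - x) (x - v)
  linarith

lemma sum_sq_swap_mul_sub {n : ℕ} (f : Fin n → ℝ) (b s : Fin n) (e : Equiv.Perm (Fin n)) :
    ∑ i, ((f ∘ (Equiv.swap b s * e : Equiv.Perm (Fin n))) i - (f ∘ e) i) ^ 2
      ≤ 2 * (f b - f s) ^ 2 := by
  have h : ∑ i, ((f ∘ (Equiv.swap b s * e : Equiv.Perm (Fin n))) i - (f ∘ e) i) ^ 2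
      = ∑ i, (f (Equiv.swap b s i) - f i) ^ 2 :=
    Equiv.sum_comp e fun i => (f (Equiv.swap b s i) - f i) ^ 2
  have hsub : ∑ i, (f (Equiv.swap b s i) - f i) ^ 2
      = ∑ i ∈ ({b, s} : Finset (Fin n)), (f (Equiv.swap b s i) - f i) ^ 2 := by
    refine (Finset.sum_subset (Finset.subset_univ _) fun i _ hi => ?_).symm
    simp only [Finset.mem_insert, Finset.mem_singleton, not_or] at hi
    rw [Equiv.swap_apply_of_ne_of_ne hi.1 hi.2, sub_self, zero_pow two_ne_zero]
  rw [h, hsub]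
  by_cases hbs : b = s
  · simp [hbs]
  · rw [Finset.sum_pair hbs, Equiv.swap_apply_left, Equiv.swap_apply_right]
    exact le_of_eq (by ring)

/-- A large value `f b` hidden at an unknown position among the small values `f s`, `s ∈ S`,
cannot be located, so the block has risk of order `δ²` on average. -/
lemma card_mul_le_sum_blockRisk {σ2 : ℝ} (hσ : 0 < σ2) {n : ℕ} (hn : 0 < n) (f : Fin n → ℝ)
    {T : (Fin n → ℝ) → Fin n → ℝ} (hT : Measurable T) {b : Fin n} {S : Finset (Fin n)}
    (hbS : b ∉ S) {δ D : ℝ} (hδ : 0 ≤ δ) (hδS : ∀ s ∈ S, δ ≤ f b - f s)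
    (hDS : ∀ s ∈ S, f b - f s ≤ D)
    (hS : 4 * Real.exp (n / σ2 * (2 * D ^ 2)) ≤ S.card) (e : Equiv.Perm (Fin n)) :
    S.card * ENNReal.ofReal (δ ^ 2 / 8)
      ≤ ∑ s ∈ S, blockRisk σ2 f T (insert b S) (Equiv.swap b s * e) := by
  set V := insert b S
  set A : Fin n → Set (Fin n → ℝ) :=
    fun s => {y | blockLoss f T V (Equiv.swap b s * e) y < δ ^ 2 / 4}
  set P : Fin n → Measure (Fin n → ℝ) :=
    fun s => seqLaw σ2 n (f ∘ (Equiv.swap b s * e : Equiv.Perm (Fin n)))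
  have hA : ∀ s ∈ S, MeasurableSet (A s) := fun s _ =>
    measurableSet_lt (measurable_blockLoss f hT V _) measurable_const
  have hd : (S : Set (Fin n)).PairwiseDisjoint A := by
    intro s hs s' hs' hne
    rw [Function.onFun, Set.disjoint_left]
    intro y hy hy'
    have e1 : (Equiv.swap b s * e : Equiv.Perm (Fin n)) (e.symm s) = b := by simp
    have e2 : (Equiv.swap b s' * e : Equiv.Perm (Fin n)) (e.symm s) = s := by
      have hsb : s ≠ b := fun h => hbS (h ▸ hs)
      simp [Equiv.swap_apply_of_ne_of_ne hsb hne]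
    have l1 := (sq_sub_le_blockLoss f T y (V := V) (e := Equiv.swap b s * e) (j := e.symm s)
      (by rw [e1]; exact Finset.mem_insert_self b S)).trans_lt hy
    have l2 := (sq_sub_le_blockLoss f T y (V := V) (e := Equiv.swap b s' * e) (j := e.symm s)
      (by rw [e2]; exact Finset.mem_insert_of_mem hs)).trans_lt hy'
    rw [e1] at l1
    rw [e2] at l2
    exact not_both_sq_lt hδ ((hδS s hs).trans (le_abs_self _)) l1 l2
  have hP : ∀ s ∈ S, (P s).real (A s) ^ 2
      ≤ Real.exp (n / σ2 * (2 * D ^ 2)) * (seqLaw σ2 n (f ∘ e)).real (A s) := fun s hs => by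
    refine (seqLaw_real_sq_le hσ hn (f ∘ e) _ (hA s hs)).trans ?_
    gcongr
    refine (sum_sq_swap_mul_sub f b s e).trans ?_
    have h0 := hδS s hs
    have h1 := hDS s hs
    gcongr
    exact hδ.trans h0
  have hsum := sum_measureReal_le_half (seqLaw σ2 n (f ∘ e)) P S A hA hd hP
    (Real.exp_pos _).le hS
  calc (S.card : ℝ≥0∞) * ENNReal.ofReal (δ ^ 2 / 8)
      = ENNReal.ofReal (S.card * (δ ^ 2 / 8)) := by
        rw [ENNReal.ofReal_mul (Nat.cast_nonneg _), ENNReal.ofReal_natCast]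
    _ ≤ ENNReal.ofReal (∑ s ∈ S, δ ^ 2 / 4 * (1 - (P s).real (A s))) := by
        refine ENNReal.ofReal_le_ofReal ?_
        rw [← Finset.mul_sum, Finset.sum_sub_distrib, Finset.sum_const, nsmul_eq_mul, mul_one]
        nlinarith [sq_nonneg δ]
    _ = ∑ s ∈ S, ENNReal.ofReal (δ ^ 2 / 4 * (1 - (P s).real (A s))) :=
        ENNReal.ofReal_sum_of_nonneg fun s _ =>
          mul_nonneg (by positivity) (sub_nonneg.2 measureReal_le_one)
    _ ≤ _ := Finset.sum_le_sum fun s _ => ofReal_le_blockRisk σ2 f hT V _ (by positivity)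

lemma card_perm_mul_le_sum_blockRisk {σ2 : ℝ} (hσ : 0 < σ2) {n : ℕ} (hn : 0 < n)
    (f : Fin n → ℝ) {T : (Fin n → ℝ) → Fin n → ℝ} (hT : Measurable T) {b : Fin n}
    {S : Finset (Fin n)} (hbS : b ∉ S) {δ D : ℝ} (hδ : 0 ≤ δ)
    (hδS : ∀ s ∈ S, δ ≤ f b - f s) (hDS : ∀ s ∈ S, f b - f s ≤ D)
    (hS : 4 * Real.exp (n / σ2 * (2 * D ^ 2)) ≤ S.card) :
    Fintype.card (Equiv.Perm (Fin n)) * ENNReal.ofReal (δ ^ 2 / 8)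
      ≤ ∑ e, blockRisk σ2 f T (insert b S) e := by
  have hcard : (S.card : ℝ≥0∞) ≠ 0 := by
    have : (0 : ℝ) < S.card := lt_of_lt_of_le (by positivity) hS
    exact_mod_cast this.ne'
  have h : (S.card : ℝ≥0∞) * (Fintype.card (Equiv.Perm (Fin n)) * ENNReal.ofReal (δ ^ 2 / 8))
      ≤ S.card * ∑ e, blockRisk σ2 f T (insert b S) e := by
    calc _ = ∑ _e : Equiv.Perm (Fin n), (S.card : ℝ≥0∞) * ENNReal.ofReal (δ ^ 2 / 8) := by
          rw [Finset.sum_const, nsmul_eq_mul, Finset.card_univ]; ring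
      _ ≤ ∑ e : Equiv.Perm (Fin n),
            ∑ s ∈ S, blockRisk σ2 f T (insert b S) (Equiv.swap b s * e) :=
          Finset.sum_le_sum fun e _ =>
            card_mul_le_sum_blockRisk hσ hn f hT hbS hδ hδS hDS hS e
      _ = ∑ s ∈ S, ∑ e, blockRisk σ2 f T (insert b S) e := by
          rw [Finset.sum_comm]
          exact Finset.sum_congr rfl fun s _ =>
            Equiv.sum_comp (Equiv.mulLeft (Equiv.swap b s)) (blockRisk σ2 f T (insert b S))
      _ = _ := by rw [Finset.sum_const, nsmul_eq_mul]
  exact (ENNReal.mul_le_mul_iff_right hcard (ENNReal.natCast_ne_top _)).1 h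

lemma sum_blockRisk_le {ι : Type*} (σ2 : ℝ) {n : ℕ} (f : Fin n → ℝ)
    {T : (Fin n → ℝ) → Fin n → ℝ} (hT : Measurable T) (I : Finset ι) (V : ι → Finset (Fin n))
    (hV : (I : Set ι).PairwiseDisjoint V) (e : Equiv.Perm (Fin n)) :
    ∑ t ∈ I, blockRisk σ2 f T (V t) e
      ≤ ∫⁻ y, ENNReal.ofReal (∑ j, (T y j - (f ∘ e) j) ^ 2) ∂(seqLaw σ2 n (f ∘ e)) := by
  classical
  unfold blockRisk
  rw [← lintegral_finsetSum _ fun t _ => (measurable_blockLoss f hT (V t) e).ennreal_ofReal]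
  refine lintegral_mono fun y => ?_
  unfold blockLoss
  rw [← ENNReal.ofReal_sum_of_nonneg fun t _ => Finset.sum_nonneg fun j _ => sq_nonneg _]
  refine ENNReal.ofReal_le_ofReal ?_
  rw [← Finset.sum_biUnion]
  · exact Finset.sum_le_sum_of_subset_of_nonneg (Finset.subset_univ _) fun _ _ _ => sq_nonneg _
  · intro t ht t' ht' hne
    refine Finset.disjoint_left.2 fun j hj hj' => ?_
    exact Finset.disjoint_left.1 (hV ht ht' hne) (Finset.mem_filter.1 hj).2
      (Finset.mem_filter.1 hj').2

/-- Lower bound for the maximal risk over all arrangements of the values of `f`, from disjoint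
blocks each hiding one large value. -/
lemma card_mul_le_iSup_risk {ι : Type*} {σ2 : ℝ} (hσ : 0 < σ2) {n : ℕ} (hn : 0 < n)
    (f : Fin n → ℝ) {T : (Fin n → ℝ) → Fin n → ℝ} (hT : Measurable T) (I : Finset ι)
    (b : ι → Fin n) (S : ι → Finset (Fin n)) (hbS : ∀ t ∈ I, b t ∉ S t)
    (hV : (I : Set ι).PairwiseDisjoint fun t => insert (b t) (S t)) {δ D : ℝ} (hδ : 0 ≤ δ)
    (hδS : ∀ t ∈ I, ∀ s ∈ S t, δ ≤ f (b t) - f s) (hDS : ∀ t ∈ I, ∀ s ∈ S t, f (b t) - f s ≤ D)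
    (hS : ∀ t ∈ I, 4 * Real.exp (n / σ2 * (2 * D ^ 2)) ≤ (S t).card) :
    ENNReal.ofReal (I.card * (δ ^ 2 / 8))
      ≤ ⨆ e : Equiv.Perm (Fin n),
          ∫⁻ y, ENNReal.ofReal (∑ j, (T y j - (f ∘ e) j) ^ 2) ∂(seqLaw σ2 n (f ∘ e)) := by
  set R : Equiv.Perm (Fin n) → ℝ≥0∞ := fun e =>
    ∫⁻ y, ENNReal.ofReal (∑ j, (T y j - (f ∘ e) j) ^ 2) ∂(seqLaw σ2 n (f ∘ e))
  set N := ((Fintype.card (Equiv.Perm (Fin n)) : ℕ) : ℝ≥0∞) with hNdef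
  have hN : N ≠ 0 := Nat.cast_ne_zero.2 Fintype.card_ne_zero
  refine (ENNReal.mul_le_mul_iff_right hN (ENNReal.natCast_ne_top _)).1 ?_
  calc N * ENNReal.ofReal (I.card * (δ ^ 2 / 8))
      = ∑ _t ∈ I, N * ENNReal.ofReal (δ ^ 2 / 8) := by
        rw [Finset.sum_const, nsmul_eq_mul, ENNReal.ofReal_mul (Nat.cast_nonneg _),
          ENNReal.ofReal_natCast]
        ring
    _ ≤ ∑ t ∈ I, ∑ e, blockRisk σ2 f T (insert (b t) (S t)) e :=
        Finset.sum_le_sum fun t ht => card_perm_mul_le_sum_blockRisk hσ hn f hT (hbS t ht) hδ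
          (hδS t ht) (hDS t ht) (hS t ht)
    _ = ∑ e, ∑ t ∈ I, blockRisk σ2 f T (insert (b t) (S t)) e := Finset.sum_comm
    _ ≤ ∑ e, R e := Finset.sum_le_sum fun e _ => sum_blockRisk_le σ2 f hT I _ hV e
    _ ≤ ∑ _e : Equiv.Perm (Fin n), ⨆ e, R e := Finset.sum_le_sum fun e _ => le_iSup R e
    _ = N * ⨆ e, R e := by rw [Finset.sum_const, nsmul_eq_mul, Finset.card_univ]

/-- Two arrangements that differ by a transposition give a positive lower bound. -/
lemma ofReal_le_iSup_risk_of_ne {σ2 : ℝ} (hσ : 0 < σ2) {n : ℕ} (hn : 0 < n) (f : Fin n → ℝ)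
    {T : (Fin n → ℝ) → Fin n → ℝ} (hT : Measurable T) (b s : Fin n) :
    ENNReal.ofReal ((f b - f s) ^ 2 / 4 *
        (1 / (4 * Real.exp (n / σ2 * (2 * (f b - f s) ^ 2)))))
      ≤ ⨆ e : Equiv.Perm (Fin n),
          ∫⁻ y, ENNReal.ofReal (∑ j, (T y j - (f ∘ e) j) ^ 2) ∂(seqLaw σ2 n (f ∘ e)) := by
  set R : Equiv.Perm (Fin n) → ℝ≥0∞ := fun e =>
    ∫⁻ y, ENNReal.ofReal (∑ j, (T y j - (f ∘ e) j) ^ 2) ∂(seqLaw σ2 n (f ∘ e))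
  set C := Real.exp (n / σ2 * (2 * (f b - f s) ^ 2)) with hCdef
  have hC1 : 1 ≤ C := Real.one_le_exp (by positivity)
  set δ := |f b - f s|
  have hδ2 : δ ^ 2 = (f b - f s) ^ 2 := sq_abs _
  set A : Equiv.Perm (Fin n) → Set (Fin n → ℝ) :=
    fun e => {y | blockLoss f T Finset.univ e y < δ ^ 2 / 4}
  have hA : ∀ e, MeasurableSet (A e) := fun e =>
    measurableSet_lt (measurable_blockLoss f hT _ _) measurable_const
  have hR : ∀ e : Equiv.Perm (Fin n), ENNReal.ofReal (δ ^ 2 / 4 * (1 - (seqLaw σ2 n (f ∘ e)).real (A e))) ≤ R e :=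
    fun e => by
      refine (ofReal_le_blockRisk σ2 f hT Finset.univ e (by positivity)).trans (le_of_eq ?_)
      simp [R, blockRisk, blockLoss]
  have hdisj : Disjoint (A 1) (A (Equiv.swap b s)) := by
    refine Set.disjoint_left.2 fun y hy hy' => ?_
    have l1 := (sq_sub_le_blockLoss f T y (V := Finset.univ) (e := 1) (j := b)
      (Finset.mem_univ _)).trans_lt hy
    have l2 := (sq_sub_le_blockLoss f T y (V := Finset.univ) (e := Equiv.swap b s) (j := b)
      (Finset.mem_univ _)).trans_lt hy'
    rw [Equiv.Perm.one_apply] at l1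
    rw [Equiv.swap_apply_left] at l2
    exact not_both_sq_lt (abs_nonneg _) le_rfl l1 l2
  set P₀ := seqLaw σ2 n (f ∘ (1 : Equiv.Perm (Fin n)))
  set P₁ := seqLaw σ2 n (f ∘ (Equiv.swap b s : Equiv.Perm (Fin n)))
  have hsq : P₁.real (A (Equiv.swap b s)) ^ 2 ≤ C * P₀.real (A (Equiv.swap b s)) := by
    refine (seqLaw_real_sq_le hσ hn (f ∘ (1 : Equiv.Perm (Fin n))) _ (hA _)).trans ?_
    rw [hCdef]
    gcongr
    simpa using sum_sq_swap_mul_sub f b s 1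
  have hadd : P₀.real (A 1) + P₀.real (A (Equiv.swap b s)) ≤ 1 := by
    rw [← measureReal_union hdisj (hA _)]
    exact measureReal_le_one
  have hsmall : 1 / (4 * C) ≤ 1 / 2 := by
    rw [div_le_div_iff₀ (by positivity) (by norm_num)]; linarith
  rw [← hδ2]
  by_cases h : 1 / (4 * C) ≤ 1 - P₀.real (A 1)
  · refine (ENNReal.ofReal_le_ofReal ?_).trans ((hR 1).trans (le_iSup R 1))
    gcongr
  · refine (ENNReal.ofReal_le_ofReal ?_).trans
      ((hR (Equiv.swap b s)).trans (le_iSup R (Equiv.swap b s)))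
    refine mul_le_mul_of_nonneg_left ?_ (by positivity)
    have h4 : C * P₀.real (A (Equiv.swap b s)) ≤ 1 / 4 := by
      calc _ ≤ C * (1 / (4 * C)) := by
            refine mul_le_mul_of_nonneg_left ?_ (by positivity)
            linarith
        _ = 1 / 4 := by field_simp
    have h5 : P₁.real (A (Equiv.swap b s)) ≤ 1 / 2 :=
      (abs_le_of_sq_le_sq' (by linarith) (by norm_num)).2
    linarith


/-- The decreasing power sequence `1^{-α}, …, n^{-α}`. -/
noncomputable def powerSeq (α : ℝ) (n : ℕ) (j : Fin n) : ℝ := (((j : ℕ) : ℝ) + 1) ^ (-α)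

/-- The maximal risk of `T` over `ThetaSet α n`. -/
noncomputable def maxRisk (α σ2 : ℝ) (n : ℕ) (T : (Fin n → ℝ) → Fin n → ℝ) : ℝ≥0∞ :=
  ⨆ θ ∈ ThetaSet α n, ∫⁻ y, ENNReal.ofReal (∑ j, (T y j - θ j) ^ 2) ∂(seqLaw σ2 n θ)

lemma iSup_perm_le_maxRisk (α σ2 : ℝ) (n : ℕ) (T : (Fin n → ℝ) → Fin n → ℝ) :
    ⨆ e : Equiv.Perm (Fin n), ∫⁻ y, ENNReal.ofReal (∑ j, (T y j - (powerSeq α n ∘ e) j) ^ 2)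
        ∂(seqLaw σ2 n (powerSeq α n ∘ e)) ≤ maxRisk α σ2 n T :=
  iSup_le fun e => le_iSup₂ (f := fun θ (_ : θ ∈ ThetaSet α n) =>
    ∫⁻ y, ENNReal.ofReal (∑ j, (T y j - θ j) ^ 2) ∂(seqLaw σ2 n θ))
    (powerSeq α n ∘ e) ⟨e, fun _ => rfl⟩

lemma powerLaw_block_le_maxRisk {α σ2 : ℝ} (hα : 1 / 2 < α) (hσ : 0 < σ2) {n k L : ℕ}
    (hk : 0 < k) (hkL : 8 * k + k * L ≤ n)
    (hL : 4 * Real.exp (n / σ2 * (2 * ((k : ℝ) ^ (-α)) ^ 2)) ≤ L)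
    {T : (Fin n → ℝ) → Fin n → ℝ} (hT : Measurable T) :
    ENNReal.ofReal (k * (((2 * k : ℝ) ^ (-α) / 2) ^ 2 / 8)) ≤ maxRisk α σ2 n T := by
  have hk' : (0 : ℝ) < k := Nat.cast_pos.2 hk
  have hn : 0 < n := by omega
  have hbn : ∀ t : Fin k, k + (t : ℕ) < n := fun t => by
    have := t.2
    have := Nat.zero_le (k * L)
    omega
  set b : Fin k → Fin n := fun t => ⟨k + t, hbn t⟩
  set S : Fin k → Finset (Fin n) :=
    fun t => Finset.univ.filter fun v => 8 * k ≤ (v : ℕ) ∧ (v : ℕ) % k = t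
  have hSL : ∀ t, L ≤ (S t).card := fun t => by
    have hlt : ∀ i : Fin L, 8 * k + t + k * i < n := fun i => by
      have h1 : k * (i + 1) ≤ k * L := Nat.mul_le_mul_left k i.2
      rw [Nat.mul_add] at h1
      have := t.2
      omega
    have := Finset.card_le_card_of_injOn (s := (Finset.univ : Finset (Fin L))) (t := S t)
      (fun i => (⟨8 * k + t + k * i, hlt i⟩ : Fin n)) ?_ ?_
    · simpa using this
    · intro i _
      have hmod : (8 * k + t + k * i) % k = t := by
        rw [Nat.add_mul_mod_self_left, Nat.add_comm, Nat.add_mul_mod_self_right,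
          Nat.mod_eq_of_lt t.2]
      simp only [S, Finset.coe_filter, Finset.mem_univ, true_and, Set.mem_ofPred_eq]
      exact ⟨by omega, hmod⟩
    · intro i _ j _ hij
      have h1 : k * (i : ℕ) = k * j := by simpa using congrArg Fin.val hij
      exact Fin.ext (Nat.eq_of_mul_eq_mul_left hk h1)
  have hbS : ∀ t ∈ Finset.univ, b t ∉ S t := fun t _ h => by
    have h1 := (Finset.mem_filter.1 h).2.1
    have h2 : 8 * k ≤ k + t := h1
    have := t.2
    omega
  have hVmod : ∀ t, ∀ v ∈ insert (b t) (S t), (v : ℕ) % k = t := fun t v hv => by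
    rcases Finset.mem_insert.1 hv with rfl | hv
    · simp [b, Nat.mod_eq_of_lt t.2]
    · exact (Finset.mem_filter.1 hv).2.2
  have hV : ((Finset.univ : Finset (Fin k)) : Set (Fin k)).PairwiseDisjoint
      fun t => insert (b t) (S t) := fun t _ t' _ hne =>
    Finset.disjoint_left.2 fun v hv hv' =>
      hne (Fin.ext ((hVmod t v hv).symm.trans (hVmod t' v hv')))
  have hα0 : -α ≤ 0 := by linarith
  have hb1 : ∀ t, (2 * k : ℝ) ^ (-α) ≤ powerSeq α n (b t) := fun t => by
    refine Real.rpow_le_rpow_of_nonpos (by positivity) ?_ hα0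
    have : k + (t : ℕ) + 1 ≤ 2 * k := by have := t.2; omega
    exact_mod_cast this
  have hb2 : ∀ t, powerSeq α n (b t) ≤ (k : ℝ) ^ (-α) := fun t => by
    refine Real.rpow_le_rpow_of_nonpos hk' ?_ hα0
    have : k ≤ k + (t : ℕ) + 1 := by omega
    exact_mod_cast this
  have hs0 : ∀ v, 0 ≤ powerSeq α n v := fun v => by unfold powerSeq; positivity
  have hs : ∀ t, ∀ s ∈ S t, powerSeq α n s ≤ (2 * k : ℝ) ^ (-α) / 2 := fun t s hs => by
    have h1 : 8 * k ≤ (s : ℕ) + 1 := (Finset.mem_filter.1 hs).2.1.trans (Nat.le_succ _)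
    have h2 : (4 : ℝ) ^ (-α) ≤ 1 / 2 := by
      calc (4 : ℝ) ^ (-α) ≤ 4 ^ (-(1 / 2) : ℝ) :=
            Real.rpow_le_rpow_of_exponent_le (by norm_num) (by linarith)
        _ = 1 / 2 := by
          rw [Real.rpow_neg (by norm_num), ← Real.sqrt_eq_rpow,
            show (4 : ℝ) = 2 ^ 2 by norm_num, Real.sqrt_sq (by norm_num)]
          norm_num
    calc powerSeq α n s ≤ (2 * k * 4 : ℝ) ^ (-α) := by
          refine Real.rpow_le_rpow_of_nonpos (by positivity) ?_ hα0
          have : ((8 * k : ℕ) : ℝ) ≤ ((s : ℕ) + 1 : ℕ) := Nat.cast_le.2 h1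
          push_cast at this
          linarith
      _ = (2 * k : ℝ) ^ (-α) * 4 ^ (-α) := Real.mul_rpow (by positivity) (by norm_num)
      _ ≤ (2 * k : ℝ) ^ (-α) * (1 / 2) := by gcongr
      _ = _ := by ring
  have h := card_mul_le_iSup_risk hσ hn (powerSeq α n) hT Finset.univ b S hbS hV
    (δ := (2 * k : ℝ) ^ (-α) / 2) (D := (k : ℝ) ^ (-α)) (by positivity)
    (fun t _ s hst => by linarith [hb1 t, hs t s hst])
    (fun t _ s _ => by linarith [hb2 t, hs0 s])
    (fun t _ => hL.trans (Nat.cast_le.2 (hSL t)))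
  rw [Finset.card_univ, Fintype.card_fin] at h
  exact h.trans (iSup_perm_le_maxRisk α σ2 n T)

/-- For each fixed `n ≥ 2` the maximal risk is bounded below uniformly over estimators. -/
lemma exists_pos_le_maxRisk {α σ2 : ℝ} (hα : 1 / 2 < α) (hσ : 0 < σ2) {n : ℕ} (hn : 2 ≤ n) :
    ∃ r : ℝ, 0 < r ∧ ∀ T : (Fin n → ℝ) → Fin n → ℝ, Measurable T →
      ENNReal.ofReal r ≤ maxRisk α σ2 n T := by
  set b : Fin n := ⟨0, by omega⟩
  set s : Fin n := ⟨1, by omega⟩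
  refine ⟨_, ?_, fun T hT => (ofReal_le_iSup_risk_of_ne hσ (by omega) (powerSeq α n) hT
    b s).trans (iSup_perm_le_maxRisk α σ2 n T)⟩
  have hne : powerSeq α n b - powerSeq α n s ≠ 0 := by
    have h2 : (2 : ℝ) ^ (-α) < 1 :=
      Real.rpow_lt_one_of_one_lt_of_neg (by norm_num) (by linarith)
    have : powerSeq α n b - powerSeq α n s = 1 - 2 ^ (-α) := by
      simp [powerSeq, b, s, one_add_one_eq_two]
    rw [this]
    linarith
  have : 0 < (powerSeq α n b - powerSeq α n s) ^ 2 := by positivity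
  positivity

lemma exists_eventually_le_maxRisk {α σ2 : ℝ} (hα : 1 / 2 < α) (hσ : 0 < σ2) :
    ∃ c : ℝ, 0 < c ∧ ∀ᶠ n : ℕ in Filter.atTop,
      ∀ T : (Fin n → ℝ) → Fin n → ℝ, Measurable T →
        ENNReal.ofReal (c * ((n : ℝ) / Real.log n) ^ ((-1 : ℝ) + 1 / (2 * α)))
          ≤ maxRisk α σ2 n T := by
  have hα0 : 0 < α := by linarith
  set β : ℝ := 1 - 1 / (2 * α) with hβ
  have hβ0 : 0 < β := by
    rw [hβ, sub_pos, div_lt_one (by positivity)]; linarith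
  set a : ℝ := 4 / (β * σ2) with ha
  have ha0 : 0 < a := by positivity
  set q : ℝ := 1 / (2 * α) with hq
  have hq0 : 0 < q := by positivity
  set c₁ : ℝ := a ^ q with hc₁
  have hc₁0 : 0 < c₁ := by positivity
  refine ⟨2 ^ (-(2 * α)) / 32 * (2 ^ (1 - 2 * α) * a ^ (-β)), by positivity, ?_⟩
  have ev1 : ∀ᶠ n : ℕ in Filter.atTop, Real.log n ≤ a * n := by
    have := (Real.isLittleO_log_id_atTop.def ha0).natCast_atTop
    filter_upwards [this] with n hn
    simp only [Real.norm_eq_abs, id, Nat.abs_cast] at hn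
    exact (le_abs_self _).trans hn
  have ev2 : ∀ᶠ n : ℕ in Filter.atTop, 1 ≤ Real.log n :=
    (Real.tendsto_log_atTop.comp tendsto_natCast_atTop_atTop).eventually_ge_atTop 1
  have ev3 : ∀ᶠ n : ℕ in Filter.atTop, 13 * (c₁ + 1) ≤ (n : ℝ) ^ (β / 2) :=
    ((tendsto_rpow_atTop (by positivity)).comp tendsto_natCast_atTop_atTop).eventually_ge_atTop _
  filter_upwards [ev1, ev2, ev3, Filter.eventually_ge_atTop 1] with n h1 h2 h3 hn1 T hT
  have hn : (1 : ℝ) ≤ n := by exact_mod_cast hn1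
  have hlog : 0 < Real.log n := by linarith
  set M : ℝ := n / Real.log n with hM
  have hM0 : 0 < M := by positivity
  have hMn : M ≤ n := div_le_self (by linarith) h2
  have haM : 1 ≤ a * M := by
    rw [hM, mul_div_assoc', one_le_div hlog]; exact h1
  set K : ℝ := (a * M) ^ q with hK
  have hK1 : 1 ≤ K := Real.one_le_rpow haM hq0.le
  set k : ℕ := ⌈K⌉₊ with hkdef
  have hKk : K ≤ k := Nat.le_ceil K
  have hkK : (k : ℝ) < K + 1 := Nat.ceil_lt_add_one (by linarith)
  have hk0 : (0 : ℝ) < k := by linarith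
  have hkpos : 0 < k := by exact_mod_cast hk0
  have hKc : K ≤ c₁ * (n : ℝ) ^ q := by
    rw [hc₁, ← Real.mul_rpow ha0.le (by linarith)]
    exact Real.rpow_le_rpow (by positivity) (by gcongr) hq0.le
  have hnq : 1 ≤ (n : ℝ) ^ q := Real.one_le_rpow hn hq0.le
  have hkn : (k : ℝ) ≤ (c₁ + 1) * (n : ℝ) ^ q := by linarith
  have hnk : (n : ℝ) ^ (β / 2) * 13 ≤ n / k := by
    rw [le_div_iff₀ hk0]
    have hsplit : (n : ℝ) = (n : ℝ) ^ (β / 2) * (n : ℝ) ^ (β / 2) * (n : ℝ) ^ q := by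
      rw [← Real.rpow_add (by linarith), ← Real.rpow_add (by linarith),
        show β / 2 + β / 2 + q = 1 by rw [hβ]; ring, Real.rpow_one]
    calc (n : ℝ) ^ (β / 2) * 13 * k
        ≤ (n : ℝ) ^ (β / 2) * 13 * ((c₁ + 1) * (n : ℝ) ^ q) := by gcongr
      _ = (n : ℝ) ^ (β / 2) * (13 * (c₁ + 1)) * (n : ℝ) ^ q := by ring
      _ ≤ (n : ℝ) ^ (β / 2) * (n : ℝ) ^ (β / 2) * (n : ℝ) ^ q := by gcongr
      _ = n := hsplit.symm
  have hx1 : 1 ≤ (n : ℝ) ^ (β / 2) := Real.one_le_rpow hn (by positivity)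
  have hfl : (n : ℝ) / k < (n / k : ℕ) + 1 := by
    rw [← Nat.floor_div_eq_div (K := ℝ)]
    exact Nat.lt_floor_add_one _
  have h8 : 8 ≤ n / k := by
    have : (8 : ℝ) ≤ (n / k : ℕ) := by linarith
    exact_mod_cast this
  have hkL : 8 * k + k * (n / k - 8) ≤ n := by
    calc 8 * k + k * (n / k - 8) = k * (8 + (n / k - 8)) := by ring
      _ = k * (n / k) := by rw [Nat.add_sub_cancel' h8]
      _ ≤ n := Nat.mul_div_le n k
  have hpow : ∀ x : ℝ, 0 < x → (x ^ (-α)) ^ 2 = x ^ (-(2 * α)) := fun x hx => by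
    rw [← Real.rpow_natCast, ← Real.rpow_mul hx.le]
    congr 1
    push_cast
    ring
  have hKα : K ^ (-(2 * α)) = (a * M)⁻¹ := by
    rw [hK, ← Real.rpow_mul (by positivity), ← Real.rpow_neg_one]
    congr 1
    rw [hq]
    field_simp
  have hexp : (n : ℝ) / σ2 * (2 * ((k : ℝ) ^ (-α)) ^ 2) ≤ Real.log n * (β / 2) := by
    calc (n : ℝ) / σ2 * (2 * ((k : ℝ) ^ (-α)) ^ 2) ≤ (n : ℝ) / σ2 * (2 * (a * M)⁻¹) := by
          rw [hpow _ hk0, ← hKα]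
          have := Real.rpow_le_rpow_of_nonpos (by linarith) hKk
            (by linarith : -(2 * α) ≤ 0)
          gcongr
      _ = Real.log n * (β / 2) := by
          rw [ha, hM]
          field_simp
          norm_num
  have hL : 4 * Real.exp (n / σ2 * (2 * ((k : ℝ) ^ (-α)) ^ 2)) ≤ ((n / k - 8 : ℕ) : ℝ) := by
    have : Real.exp (n / σ2 * (2 * ((k : ℝ) ^ (-α)) ^ 2)) ≤ (n : ℝ) ^ (β / 2) := by
      rw [Real.rpow_def_of_pos (by linarith : (0 : ℝ) < n)]
      exact Real.exp_le_exp.2 hexp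
    rw [Nat.cast_sub h8]
    push_cast
    linarith
  refine le_trans (ENNReal.ofReal_le_ofReal ?_)
    (powerLaw_block_le_maxRisk hα hσ hkpos hkL hL hT)
  have e1 : (k : ℝ) * (((2 * k : ℝ) ^ (-α) / 2) ^ 2 / 8)
      = 2 ^ (-(2 * α)) / 32 * (k : ℝ) ^ (1 - 2 * α) := by
    rw [div_pow, hpow _ (by positivity), Real.mul_rpow (by norm_num) hk0.le,
      show 1 - 2 * α = 1 + -(2 * α) by ring, Real.rpow_add hk0, Real.rpow_one]
    ring
  have e2 : a ^ (-β) * M ^ ((-1 : ℝ) + q) = K ^ (1 - 2 * α) := by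
    rw [hK, ← Real.rpow_mul (by positivity), Real.mul_rpow ha0.le hM0.le]
    have : q * (1 - 2 * α) = -β := by
      rw [hβ, hq]; field_simp; ring
    rw [this, show (-1 : ℝ) + q = -β by rw [hβ]; ring]
  rw [e1, mul_assoc, mul_assoc, e2, ← Real.mul_rpow (by norm_num) (by linarith)]
  refine mul_le_mul_of_nonneg_left ?_ (by positivity)
  exact Real.rpow_le_rpow_of_nonpos hk0 (by linarith) (by linarith)

lemma exists_pos_forall_le_maxRisk {α σ2 : ℝ} (hα : 1 / 2 < α) (hσ : 0 < σ2) :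
    ∃ c : ℝ, 0 < c ∧ ∀ n : ℕ, 1 ≤ n → ∀ T : (Fin n → ℝ) → Fin n → ℝ, Measurable T →
      ENNReal.ofReal (c * ((n : ℝ) / Real.log n) ^ ((-1 : ℝ) + 1 / (2 * α)))
        ≤ maxRisk α σ2 n T := by
  have hne : (-1 : ℝ) + 1 / (2 * α) < 0 := by
    have : 1 / (2 * α) < 1 := by rw [div_lt_one (by linarith)]; linarith
    linarith
  set p : ℕ → ℝ := fun n => ((n : ℝ) / Real.log n) ^ ((-1 : ℝ) + 1 / (2 * α)) with hp
  have hp0 : ∀ n, 0 ≤ p n := fun n =>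
    Real.rpow_nonneg (div_nonneg n.cast_nonneg (Real.log_natCast_nonneg n)) _
  have hpt : ∀ n : ℕ, 1 ≤ n → ∃ c : ℝ, 0 < c ∧ ∀ T : (Fin n → ℝ) → Fin n → ℝ, Measurable T →
      ENNReal.ofReal (c * p n) ≤ maxRisk α σ2 n T := by
    intro n hn
    rcases hn.eq_or_lt with rfl | hn
    · refine ⟨1, one_pos, fun T _ => ?_⟩
      simp [hp, Real.zero_rpow (by linarith : (-1 : ℝ) + 1 / (2 * α) ≠ 0), -one_div]
    · obtain ⟨r, hr, h⟩ := exists_pos_le_maxRisk hα hσ hn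
      have hn1 : (1 : ℝ) < n := by exact_mod_cast hn
      have hpn : 0 < p n :=
        Real.rpow_pos_of_pos (div_pos (by linarith) (Real.log_pos hn1)) _
      exact ⟨r / p n, by positivity, fun T hT => by
        rw [div_mul_cancel₀ _ hpn.ne']; exact h T hT⟩
  have hmono : ∀ {n : ℕ} {c c' : ℝ} {x : ℝ≥0∞}, c' ≤ c → ENNReal.ofReal (c * p n) ≤ x →
      ENNReal.ofReal (c' * p n) ≤ x := fun {n} {c} {c'} {x} hc h =>
    (ENNReal.ofReal_le_ofReal (mul_le_mul_of_nonneg_right hc (hp0 n))).trans h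
  obtain ⟨c₀, hc₀, hev⟩ := exists_eventually_le_maxRisk hα hσ
  obtain ⟨N, hN⟩ := Filter.eventually_atTop.1 hev
  have hfin : ∀ N : ℕ, ∃ c : ℝ, 0 < c ∧ ∀ n < N, 1 ≤ n →
      ∀ T : (Fin n → ℝ) → Fin n → ℝ, Measurable T →
        ENNReal.ofReal (c * p n) ≤ maxRisk α σ2 n T := by
    intro N
    induction N with
    | zero => exact ⟨1, one_pos, fun n hn => absurd hn (Nat.not_lt_zero n)⟩
    | succ N ih =>
      obtain ⟨c, hc, h⟩ := ih
      rcases Nat.eq_zero_or_pos N with rfl | hN0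
      · exact ⟨1, one_pos, fun n hn hn1 => by omega⟩
      obtain ⟨c', hc', h'⟩ := hpt N hN0
      refine ⟨min c c', lt_min hc hc', fun n hn hn1 T hT => ?_⟩
      rcases Nat.lt_succ_iff_lt_or_eq.1 hn with hlt | rfl
      · exact hmono (min_le_left _ _) (h n hlt hn1 T hT)
      · exact hmono (min_le_right _ _) (h' T hT)
  obtain ⟨c₁, hc₁, h₁⟩ := hfin N
  refine ⟨min c₀ c₁, lt_min hc₀ hc₁, fun n hn T hT => ?_⟩
  rcases lt_or_ge n N with hlt | hge
  · exact hmono (min_le_right _ _) (h₁ n hlt hn T hT)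
  · exact hmono (min_le_left _ _) (hN n hge T hT)


lemma half_min_le_shrinkage {t x s : ℝ} (hs : 0 ≤ s) :
    min (x ^ 2) s / 2 ≤ (1 - t) ^ 2 * x ^ 2 + s * t ^ 2 := by
  have h1 : (1 - t) ^ 2 * min (x ^ 2) s ≤ (1 - t) ^ 2 * x ^ 2 :=
    mul_le_mul_of_nonneg_left (min_le_left _ _) (sq_nonneg _)
  have h2 : min (x ^ 2) s * t ^ 2 ≤ s * t ^ 2 :=
    mul_le_mul_of_nonneg_right (min_le_right _ _) (sq_nonneg _)
  have h0 : 0 ≤ min (x ^ 2) s := le_min (sq_nonneg _) hs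
  nlinarith [mul_nonneg h0 (sq_nonneg (2 * t - 1))]

lemma isSubsetWeight_single {p : ℕ} {J : Finset ℕ} (hJ : J ⊆ Finset.Icc 1 p) :
    IsSubsetWeight p (fun I => if I = J then 1 else 0) := by
  refine ⟨fun I _ => by positivity, ?_⟩
  rw [Finset.sum_ite_eq', if_pos (Finset.mem_powerset.2 hJ)]

lemma coordWeight_single {p : ℕ} {J : Finset ℕ} (hJ : J ⊆ Finset.Icc 1 p) (j : ℕ) :
    coordWeight p (fun I => if I = J then 1 else 0) j = if j ∈ J then 1 else 0 := by
  unfold coordWeight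
  rw [Finset.sum_ite_eq']
  simp [hJ]

lemma sum_half_min_le_rhoMA (n p : ℕ) {σ2 : ℝ} (hσ : 0 ≤ σ2) (θ : ℕ → ℝ) :
    ∑ j ∈ Finset.Icc 1 p, min (θ j ^ 2) (σ2 / n) / 2 ≤ rhoMA n p σ2 θ := by
  refine le_csInf ⟨_, _, isSubsetWeight_single (Finset.empty_subset _), rfl⟩ ?_
  rintro r ⟨v, _, rfl⟩
  refine Finset.sum_le_sum fun j _ => ?_
  rw [mul_div_right_comm]
  exact half_min_le_shrinkage (by positivity)

lemma rhoMA_le (n p : ℕ) {σ2 : ℝ} (hσ : 0 ≤ σ2) (θ : ℕ → ℝ) {m : ℕ} (hm : m ≤ p) :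
    rhoMA n p σ2 θ ≤ m * (σ2 / n) + ∑ j ∈ Finset.Ioc m p, θ j ^ 2 := by
  have hJ : Finset.Icc 1 m ⊆ Finset.Icc 1 p := Finset.Icc_subset_Icc_right hm
  have hbdd : BddBelow {r : ℝ | ∃ v : Finset ℕ → ℝ,
      IsSubsetWeight p v ∧ r = subsetMARisk n p σ2 θ v} := by
    refine ⟨0, ?_⟩
    rintro r ⟨v, _, rfl⟩
    exact Finset.sum_nonneg fun j _ => by positivity
  refine (csInf_le hbdd ⟨_, isSubsetWeight_single hJ, rfl⟩).trans (le_of_eq ?_)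
  unfold subsetMARisk
  simp_rw [coordWeight_single hJ]
  have hsplit : Finset.Icc 1 p = Finset.Icc 1 m ∪ Finset.Ioc m p := by
    ext j; simp only [Finset.mem_union, Finset.mem_Icc, Finset.mem_Ioc]; omega
  have hdisj : Disjoint (Finset.Icc 1 m) (Finset.Ioc m p) :=
    Finset.disjoint_left.2 fun j h1 h2 => by
      simp only [Finset.mem_Icc, Finset.mem_Ioc] at h1 h2; omega
  rw [hsplit, Finset.sum_union hdisj]
  congr 1
  · rw [Finset.sum_congr rfl fun j hj => by rw [if_pos hj]]
    simp
  · refine Finset.sum_congr rfl fun j hj => ?_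
    rw [if_neg (Finset.disjoint_right.1 hdisj hj)]
    simp

lemma rpow_neg_le_sub {s : ℝ} (hs : 0 < s) {x : ℝ} (hx : 1 ≤ x) :
    s * (x + 1) ^ (-(s + 1)) ≤ x ^ (-s) - (x + 1) ^ (-s) := by
  have hx0 : 0 < x := by linarith
  have h1 : (x + 1) ^ (-(s + 1)) = (x + 1) ^ (-s) * (x + 1)⁻¹ := by
    rw [neg_add, Real.rpow_add (by linarith), Real.rpow_neg_one]
  have h2 : x ^ (-s) = (x + 1) ^ (-s) * (x / (x + 1)) ^ (-s) := by
    rw [← Real.mul_rpow (by linarith) (by positivity)]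
    congr 1
    field_simp
  have h3 : 1 + s * (x + 1)⁻¹ ≤ (x / (x + 1)) ^ (-s) := by
    rw [Real.rpow_def_of_pos (by positivity)]
    have hlog : Real.log (x / (x + 1)) ≤ -(x + 1)⁻¹ := by
      refine (Real.log_le_sub_one_of_pos (by positivity)).trans (le_of_eq ?_)
      field_simp
      ring
    calc 1 + s * (x + 1)⁻¹ ≤ Real.exp (s * (x + 1)⁻¹) := by
          linarith [Real.add_one_le_exp (s * (x + 1)⁻¹)]
      _ ≤ _ := Real.exp_le_exp.2 (by nlinarith)
  rw [h1, h2]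
  have := mul_le_mul_of_nonneg_left h3 (Real.rpow_nonneg (by linarith : 0 ≤ x + 1) (-s))
  linarith

lemma sum_Ioc_rpow_le {s : ℝ} (hs : 0 < s) {m n : ℕ} (hm : 1 ≤ m) (hmn : m ≤ n) :
    ∑ j ∈ Finset.Ioc m n, (j : ℝ) ^ (-(s + 1)) ≤ (m : ℝ) ^ (-s) / s := by
  have key : s * ∑ j ∈ Finset.Ioc m n, (j : ℝ) ^ (-(s + 1)) ≤ (m : ℝ) ^ (-s) - (n : ℝ) ^ (-s) := by
    induction n, hmn using Nat.le_induction with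
    | base => simp
    | succ n hmn ih =>
      rw [Finset.sum_Ioc_succ_top hmn, mul_add]
      have := rpow_neg_le_sub hs (x := n) (by exact_mod_cast hm.trans hmn)
      push_cast
      linarith
  rw [le_div_iff₀ hs]
  have : 0 ≤ (n : ℝ) ^ (-s) := by positivity
  linarith

/-- The ideal model-averaging risk at `(1^{-α}, …, n^{-α})` has order `n^{-1 + 1/(2α)}`. -/
lemma rhoMA_powerSeq_asympEquiv {α σ2 : ℝ} (hα : 1 / 2 < α) (hσ : 0 < σ2) :
    AsympEquiv (fun n => rhoMA n n σ2 fun j => (j : ℝ) ^ (-α))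
      (fun n => (n : ℝ) ^ ((-1 : ℝ) + 1 / (2 * α))) := by
  have hα0 : 0 < α := by linarith
  set q : ℝ := 1 / (2 * α) with hq
  have hq0 : 0 < q := by positivity
  have hq1 : q < 1 := by rw [hq, div_lt_one (by positivity)]; linarith
  set s : ℝ := 2 * α - 1 with hs
  have hs0 : 0 < s := by linarith
  have hsq : ∀ j : ℕ, ((j : ℝ) ^ (-α)) ^ 2 = (j : ℝ) ^ (-(s + 1)) := fun j => by
    rw [← Real.rpow_natCast, ← Real.rpow_mul j.cast_nonneg]
    congr 1
    push_cast
    ring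
  have h2s : 0 < (2 : ℝ) ^ s := by positivity
  have hlo : 0 < min 1 σ2 / 4 := by have := lt_min one_pos hσ; positivity
  have hbound : ∀ n : ℕ, 1 ≤ n → min 1 σ2 / 4 * (n : ℝ) ^ (-1 + q)
      ≤ rhoMA n n σ2 (fun j => (j : ℝ) ^ (-α)) ∧ rhoMA n n σ2 (fun j => (j : ℝ) ^ (-α))
      ≤ (σ2 + 2 ^ s / s) * (n : ℝ) ^ (-1 + q) := by
    intro n hn1
    have hn : (1 : ℝ) ≤ n := by exact_mod_cast hn1
    have hn0 : (0 : ℝ) < n := by linarith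
    set m : ℕ := ⌊(n : ℝ) ^ q⌋₊ with hm
    have hnq : 1 ≤ (n : ℝ) ^ q := Real.one_le_rpow hn hq0.le
    have hmle : (m : ℝ) ≤ (n : ℝ) ^ q := Nat.floor_le (by linarith)
    have hm1 : 1 ≤ m := Nat.le_floor (by exact_mod_cast hnq)
    have hmR : (1 : ℝ) ≤ m := by exact_mod_cast hm1
    have hmlow : (n : ℝ) ^ q ≤ 2 * m := by
      have := Nat.lt_floor_add_one ((n : ℝ) ^ q)
      linarith
    have hmn : m ≤ n := by
      have : (m : ℝ) ≤ (n : ℝ) := hmle.trans <| by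
        simpa using Real.rpow_le_rpow_of_exponent_le hn hq1.le
      exact_mod_cast this
    have hexp : (n : ℝ) ^ (-1 + q) = (n : ℝ) ^ q / n := by
      rw [Real.rpow_add hn0, Real.rpow_neg_one]; ring
    have hrate : ((n : ℝ) ^ q) ^ (-s) = (n : ℝ) ^ (-1 + q) := by
      rw [← Real.rpow_mul hn0.le]
      congr 1
      rw [hq, hs]; field_simp; ring
    have hpow1 : ((n : ℝ) ^ q) ^ (-(s + 1)) = 1 / n := by
      rw [← Real.rpow_mul hn0.le, one_div, ← Real.rpow_neg_one]
      congr 1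
      rw [hq, hs]; field_simp; ring
    constructor
    · refine le_trans ?_ (sum_half_min_le_rhoMA n n hσ.le _)
      calc min 1 σ2 / 4 * (n : ℝ) ^ (-1 + q) ≤ m * (min 1 σ2 / n / 2) := by
            rw [hexp]
            have : min 1 σ2 / 4 * ((n : ℝ) ^ q / n) ≤ min 1 σ2 / 4 * (2 * m / n) := by gcongr
            refine this.trans (le_of_eq ?_)
            ring
        _ = ∑ j ∈ Finset.Icc 1 m, min 1 σ2 / n / 2 := by simp
        _ ≤ ∑ j ∈ Finset.Icc 1 m, min (((j : ℝ) ^ (-α)) ^ 2) (σ2 / n) / 2 := by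
            refine Finset.sum_le_sum fun j hj => ?_
            obtain ⟨hj1, hjm⟩ := Finset.mem_Icc.1 hj
            have hj0 : (0 : ℝ) < j := by exact_mod_cast hj1
            have hjq : (j : ℝ) ≤ (n : ℝ) ^ q := (Nat.cast_le.2 hjm).trans hmle
            have h1 : 1 / (n : ℝ) ≤ ((j : ℝ) ^ (-α)) ^ 2 := by
              rw [hsq, ← hpow1]
              exact Real.rpow_le_rpow_of_nonpos hj0 hjq (by linarith)
            rw [← min_div_div_right hn0.le]
            gcongr
        _ ≤ _ := Finset.sum_le_sum_of_subset_of_nonneg (Finset.Icc_subset_Icc_right hmn)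
            fun j _ _ => by positivity
    · refine (rhoMA_le n n hσ.le _ hmn).trans ?_
      simp_rw [hsq]
      have h1 : (m : ℝ) * (σ2 / n) ≤ σ2 * (n : ℝ) ^ (-1 + q) := by
        rw [hexp]
        calc (m : ℝ) * (σ2 / n) ≤ (n : ℝ) ^ q * (σ2 / n) := by gcongr
          _ = _ := by ring
      have h2 : (m : ℝ) ^ (-s) ≤ 2 ^ s * (n : ℝ) ^ (-1 + q) := by
        rw [← hrate]
        calc (m : ℝ) ^ (-s) = 2 ^ s * (2 * m : ℝ) ^ (-s) := by
              rw [Real.mul_rpow (by norm_num) (by linarith), ← mul_assoc,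
                ← Real.rpow_add (by norm_num), add_neg_cancel, Real.rpow_zero, one_mul]
          _ ≤ _ := by
              refine mul_le_mul_of_nonneg_left ?_ h2s.le
              exact Real.rpow_le_rpow_of_nonpos (by linarith) hmlow (by linarith)
      have h3 := sum_Ioc_rpow_le hs0 hm1 hmn
      calc _ ≤ σ2 * (n : ℝ) ^ (-1 + q) + 2 ^ s * (n : ℝ) ^ (-1 + q) / s := by
            refine add_le_add h1 (h3.trans ?_)
            gcongr
        _ = _ := by ring
  refine ⟨min 1 σ2 / 4, σ2 + 2 ^ s / s, hlo, ?_, ?_⟩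
  · have h := hbound 1 le_rfl
    simpa using h.1.trans h.2
  · filter_upwards [Filter.eventually_ge_atTop 1] with n hn
    exact hbound n hn

lemma exists_mem_thetaSet_maxRisk_le (α σ2 : ℝ) (n : ℕ) (T : (Fin n → ℝ) → Fin n → ℝ) :
    ∃ θ ∈ ThetaSet α n, maxRisk α σ2 n T
      ≤ ∫⁻ y, ENNReal.ofReal (∑ j, (T y j - θ j) ^ 2) ∂(seqLaw σ2 n θ) := by
  obtain ⟨e, he⟩ := Finite.exists_max fun e : Equiv.Perm (Fin n) =>
    ∫⁻ y, ENNReal.ofReal (∑ j, (T y j - (powerSeq α n ∘ e) j) ^ 2)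
      ∂(seqLaw σ2 n (powerSeq α n ∘ e))
  refine ⟨powerSeq α n ∘ e, ⟨e, fun _ => rfl⟩, iSup₂_le ?_⟩
  rintro θ ⟨e', he'⟩
  obtain rfl : θ = powerSeq α n ∘ e' := funext he'
  exact he e'


/-- Theorem 6 of the paper.  Fix `α > 1/2` and `σ² > 0`.  In the Gaussian
sequence model `y = θ + e`, `e ~ N(0, (σ²/n) Iₙ)`, with `Θ_n` the permutations of
`(1^{−α}, …, n^{−α})` and `ρ_n = ρ^{MA}` on `Θ_n`:
(i) there is `c > 0` with `sup_{θ ∈ Θ_n} E_θ ‖θ̂(y) − θ‖² ≥ c (n/log n)^{−1+1/(2α)}`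
for every `n` and measurable estimator `θ̂`, while `ρ_n ≍ n^{−1+1/(2α)}`;
(ii) consequently, for any sequence of measurable estimators there are `θ^{(n)} ∈ Θ_n`
with `E_{θ^{(n)}} ‖θ̂_n(y) − θ^{(n)}‖² / ρ_n → ∞`. -/
theorem stmt_19 (α σ2 : ℝ) (hα : 1 / 2 < α) (hσ : 0 < σ2) :
    (∃ c : ℝ, 0 < c ∧ ∀ n : ℕ, 1 ≤ n →
        ∀ θhat : (Fin n → ℝ) → (Fin n → ℝ), Measurable θhat →
          ENNReal.ofReal (c * (((n : ℝ) / Real.log n) ^ ((-1 : ℝ) + 1 / (2 * α))))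
            ≤ ⨆ θ ∈ ThetaSet α n,
                ∫⁻ y, ENNReal.ofReal (∑ j, (θhat y j - θ j) ^ 2) ∂(seqLaw σ2 n θ))
    ∧ AsympEquiv (fun n => rhoMA n n σ2 fun j => (j : ℝ) ^ (-α))
        (fun n => (n : ℝ) ^ ((-1 : ℝ) + 1 / (2 * α)))
    ∧ ∀ θhat : (n : ℕ) → (Fin n → ℝ) → (Fin n → ℝ), (∀ n, Measurable (θhat n)) →
        ∃ θseq : (n : ℕ) → (Fin n → ℝ), (∀ n, θseq n ∈ ThetaSet α n) ∧
          Filter.Tendsto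
            (fun n =>
              (∫⁻ y, ENNReal.ofReal (∑ j, (θhat n y j - θseq n j) ^ 2)
                  ∂(seqLaw σ2 n (θseq n)))
                / ENNReal.ofReal (rhoMA n n σ2 fun j => (j : ℝ) ^ (-α)))
            Filter.atTop (nhds ⊤) := by
  obtain ⟨c, hc, hlow⟩ := exists_pos_forall_le_maxRisk hα hσ
  have hρ := rhoMA_powerSeq_asympEquiv hα hσ
  refine ⟨⟨c, hc, hlow⟩, hρ, fun θhat hmeas => ?_⟩
  choose θseq hmem hmax using fun n => exists_mem_thetaSet_maxRisk_le α σ2 n (θhat n)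
  refine ⟨θseq, hmem, ?_⟩
  obtain ⟨c', C, hc', hcC, hev⟩ := hρ
  have hC : 0 < C := hc'.trans_le hcC
  set β : ℝ := 1 - 1 / (2 * α) with hβ
  have hβ0 : 0 < β := by
    rw [hβ, sub_pos, div_lt_one (by linarith)]; linarith
  have hneg : (-1 : ℝ) + 1 / (2 * α) = -β := by rw [hβ]; ring
  have hlim : Filter.Tendsto (fun n : ℕ => ENNReal.ofReal (c / C * Real.log n ^ β))
      Filter.atTop (nhds ⊤) :=
    ENNReal.tendsto_ofReal_atTop.comp
      ((((tendsto_rpow_atTop hβ0).comp Real.tendsto_log_atTop).comp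
        tendsto_natCast_atTop_atTop).const_mul_atTop (div_pos hc hC))
  refine tendsto_nhds_top_mono hlim ?_
  filter_upwards [hev, Filter.eventually_ge_atTop 2] with n hn hn2
  have hn1 : (1 : ℝ) < n := by exact_mod_cast hn2
  have hlog : 0 < Real.log n := Real.log_pos hn1
  have hpow : 0 < (n : ℝ) ^ (-β) := Real.rpow_pos_of_pos (by linarith) _
  rw [hneg] at hn
  calc ENNReal.ofReal (c / C * Real.log n ^ β)
      = ENNReal.ofReal (c * ((n : ℝ) / Real.log n) ^ (-β)) / ENNReal.ofReal (C * (n : ℝ) ^ (-β)) := by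
        rw [← ENNReal.ofReal_div_of_pos (by positivity), Real.div_rpow (by linarith) hlog.le,
          Real.rpow_neg hlog.le]
        congr 1
        field_simp
    _ ≤ _ := by
        refine ENNReal.div_le_div ?_ (ENNReal.ofReal_le_ofReal hn.2)
        rw [← hneg]
        exact (hlow n (by omega) (θhat n) (hmeas n)).trans (hmax n)
end
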